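/- arXiv:1706.03435 — 4 statements merged into one kernel-verified Lean document; each statement's English description precedes it below -/
import Mathlib

section
/- If H is a finite group and n divides |H|, then the number of elements x in H with x^n = 1 is a multiple of n. -/
open Finset Subgroup

section

variable {G : Type*} [Group G]

/-- Raising to the power `n` and to its gcd with the group order kill the same elements. -/
lemma pow_gcd_natCard_eq_one_iff (x : G) (n : ℕ) :
    x ^ n.gcd (Nat.card G) = 1 ↔ x ^ n = 1 := by
  rw [← orderOf_dvd_iff_pow_eq_one, ← orderOf_dvd_iff_pow_eq_one, Nat.dvd_gcd_iff]
  exact and_iff_left (orderOf_dvd_natCard x)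

/-- Factoring out a central subgroup of order coprime to `s` does not change the number of
solutions of `x ^ s = 1`. -/
lemma card_pow_eq_one_quotient_of_le_center (Z : Subgroup G) [Z.Normal] (hZ : Z ≤ center G)
    {s : ℕ} (hs : (Nat.card Z).Coprime s) :
    Nat.card {x : G // x ^ s = 1} = Nat.card {x : G ⧸ Z // x ^ s = 1} := by
  refine Nat.card_congr (Equiv.ofBijective
    (fun x ↦ ⟨(x.1 : G ⧸ Z), by rw [← QuotientGroup.mk_pow, x.2, QuotientGroup.mk_one]⟩)
    ⟨?_, ?_⟩)
  · rintro ⟨x, hx⟩ ⟨y, hy⟩ h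
    have hxy : x⁻¹ * y ∈ Z := QuotientGroup.eq.1 (congrArg Subtype.val h)
    have hcomm : Commute x (x⁻¹ * y) := (mem_center_iff.1 (hZ hxy) x)
    have hpow : (x⁻¹ * y) ^ s = 1 := by
      have := hcomm.mul_pow s
      rwa [mul_inv_cancel_left, hx, hy, one_mul, eq_comm] at this
    have hone : (⟨x⁻¹ * y, hxy⟩ : Z) = 1 := by
      apply (powCoprime hs).injective
      simpa [powCoprime_apply, Subtype.ext_iff] using hpow
    exact Subtype.ext (inv_mul_eq_one.1 (congrArg Subtype.val hone))
  · rintro ⟨w, hw⟩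
    obtain ⟨x, rfl⟩ := QuotientGroup.mk_surjective w
    have hx : x ^ s ∈ Z := by rwa [← QuotientGroup.mk_pow, QuotientGroup.eq_one_iff] at hw
    obtain ⟨d, hd⟩ := (powCoprime hs).surjective ⟨x ^ s, hx⟩
    have hd' : (d : G) ^ s = x ^ s := congrArg Subtype.val hd
    have hcomm : Commute x (d : G)⁻¹ := Commute.inv_right (mem_center_iff.1 (hZ d.2) x)
    refine ⟨⟨x * (d : G)⁻¹, ?_⟩, Subtype.ext ?_⟩
    · rw [hcomm.mul_pow, inv_pow, hd', mul_inv_cancel]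
    · exact QuotientGroup.eq.2 (by simp)

lemma ncard_isConj_eq_index_centralizer (g : G) :
    {x | IsConj g x}.ncard = (centralizer {g}).index := by
  have hindex : (centralizer {g}).index = (MulAction.stabilizer (ConjAct G) g).index := by
    rw [centralizer_eq_comap_stabilizer]
    exact index_comap_of_surjective (f := (ConjAct.toConjAct (G := G)).toMonoidHom) _
      ConjAct.toConjAct.surjective
  rw [hindex, MulAction.index_stabilizer]
  congr 1
  ext x
  rw [ConjAct.mem_orbit_conjAct, isConj_comm, Set.mem_ofPred_eq]

end

section

variable {G : Type*} [Group G] [Fintype G]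

/-- A divisibility criterion for the sum of a class function. -/
lemma dvd_sum_of_dvd_index_centralizer_mul {s : ℕ} (f : G → ℕ)
    (hf : ∀ x y, IsConj x y → f x = f y) (h : ∀ x, s ∣ (centralizer {x}).index * f x) :
    s ∣ ∑ x, f x := by
  classical
  rw [← sum_fiberwise univ (ConjClasses.mk : G → ConjClasses G) f]
  refine dvd_sum fun c _ ↦ ?_
  obtain ⟨x, rfl⟩ := ConjClasses.mk_surjective c
  have hfib : ∀ y, ConjClasses.mk y = ConjClasses.mk x ↔ IsConj x y := fun y ↦ by
    rw [ConjClasses.mk_eq_mk_iff_isConj, isConj_comm]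
  rw [sum_congr rfl (g := fun _ ↦ f x), sum_const, smul_eq_mul]
  · refine (h x).trans (dvd_of_eq (congrArg (· * f x) ?_))
    rw [← ncard_isConj_eq_index_centralizer, ← Set.ncard_coe_finset]
    congr 1
    ext y
    simp [hfib]
  · intro y hy
    exact (hf x y ((hfib y).1 (mem_filter.1 hy).2)).symm

open Classical in
lemma card_filter_zpowers_eq (x : G) :
    #{y : G | zpowers y = zpowers x} = (orderOf x).totient := by
  rw [← IsCyclic.card_orderOf_eq_totient (α := zpowers x) (d := orderOf x)
    (by rw [← Nat.card_eq_fintype_card, Nat.card_zpowers])]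
  symm
  refine card_bij (fun y _ ↦ y.1) ?_ (fun _ _ _ _ h ↦ Subtype.ext h) ?_
  · rintro ⟨y, hy⟩ h
    have h : orderOf y = orderOf x := by simpa using h
    rw [mem_filter_univ]
    refine eq_of_le_of_card_ge (zpowers_le.2 hy) ?_
    rw [Nat.card_zpowers, Nat.card_zpowers, h]
  · intro y hy
    rw [mem_filter_univ] at hy
    refine ⟨⟨y, hy ▸ mem_zpowers y⟩, ?_, rfl⟩
    rw [mem_filter_univ, orderOf_mk, ← Nat.card_zpowers, hy, Nat.card_zpowers]

/-- A divisibility criterion for the size of a set containing, with each element, all the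
generators of the cyclic subgroup it generates. -/
lemma dvd_card_of_dvd_totient_orderOf {m : ℕ} (S : Finset G)
    (hS : ∀ x y, zpowers x = zpowers y → x ∈ S → y ∈ S)
    (h : ∀ x ∈ S, m ∣ (orderOf x).totient) : m ∣ #S := by
  classical
  rw [card_eq_sum_card_image zpowers S]
  refine dvd_sum fun b hb ↦ ?_
  obtain ⟨x, hx, rfl⟩ := mem_image.1 hb
  refine (h x hx).trans (dvd_of_eq ?_)
  rw [← card_filter_zpowers_eq]
  congr 1
  ext y
  rw [mem_filter_univ, mem_filter]
  exact ⟨fun hy ↦ ⟨hS x y hy.symm hx, hy⟩, And.right⟩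

end

section

variable {G : Type*} [Group G] {p k s u : ℕ}

lemma pow_mul_eq_pow_of_modEq_one {x : G} (hx : x ^ (p ^ (k + 1) * s) = 1)
    (hu : u ≡ 1 [MOD p ^ (k + 1)]) : x ^ (u * s) = x ^ s := by
  rw [pow_eq_pow_iff_modEq]
  have := (hu.mul_right' s).of_dvd (orderOf_dvd_of_pow_eq_one hx)
  rwa [one_mul] at this

variable [hp : Fact p.Prime]

/-- The `p`-part of an element whose order divides `p ^ (k + 1) * s` but not `p ^ k * s`. -/
lemma orderOf_pow_eq_prime_pow {x : G} (hx : x ^ (p ^ (k + 1) * s) = 1) (hx' : x ^ (p ^ k * s) ≠ 1)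
    (hu : u ≡ 1 [MOD p ^ (k + 1)]) (hu' : s ∣ u) : orderOf (x ^ u) = p ^ (k + 1) := by
  refine orderOf_eq_prime_pow (fun h ↦ hx' ?_) ?_
  · rw [mul_comm, pow_mul, ← pow_mul_eq_pow_of_modEq_one hx hu, ← pow_mul,
      mul_right_comm, pow_mul, pow_mul, h, one_pow]
  · obtain ⟨t, rfl⟩ := hu'
    rw [← pow_mul, mul_right_comm, mul_comm s, pow_mul, hx, one_pow]

open Classical in
/-- Elements with a given `p`-part `y` correspond to elements of the centralizer of `y` whose
`s`-th power is trivial. -/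
lemma card_filter_pow_eq_card_centralizer [Fintype G] (hu : u ≡ 1 [MOD p ^ (k + 1)]) (hu' : s ∣ u)
    (hs : p.Coprime s)
    {y : G} (hy : orderOf y = p ^ (k + 1)) :
    #{x ∈ ({x : G | x ^ (p ^ (k + 1) * s) = 1 ∧ x ^ (p ^ k * s) ≠ 1} : Finset G) | x ^ u = y} =
      Nat.card {z : centralizer {y} // z ^ s = 1} := by
  have hyu : y ^ u = y := by
    conv_rhs => rw [← pow_one y]
    rwa [pow_eq_pow_iff_modEq, hy]
  rw [← Nat.card_eq_finsetCard]
  refine Nat.card_congr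
    { toFun := fun x ↦ ⟨⟨y⁻¹ * x.1, ?_⟩, Subtype.ext ?_⟩
      invFun := fun z ↦ ⟨y * z.1.1, ?_⟩
      left_inv := fun x ↦ Subtype.ext (mul_inv_cancel_left _ _)
      right_inv := fun z ↦ Subtype.ext (Subtype.ext (inv_mul_cancel_left _ _)) }
  · obtain ⟨x, hx⟩ := x
    obtain ⟨-, rfl⟩ := mem_filter.1 hx
    rw [mem_centralizer_singleton_iff]
    exact (((Commute.refl x).pow_left u).inv_left.mul_left (Commute.refl x)).pow_right u
  · obtain ⟨x, hx⟩ := x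
    obtain ⟨hxS, rfl⟩ := mem_filter.1 hx
    rw [mem_filter_univ] at hxS
    change ((x ^ u)⁻¹ * x) ^ s = 1
    rw [((Commute.refl x).pow_left u).inv_left.mul_pow, inv_pow, ← pow_mul,
      pow_mul_eq_pow_of_modEq_one hxS.1 hu, inv_mul_cancel]
  · obtain ⟨⟨z, hz⟩, hzs⟩ := z
    have hcomm : Commute y z := (mem_centralizer_singleton_iff.1 hz).symm
    replace hzs : z ^ s = 1 := congrArg Subtype.val hzs
    simp only [mem_filter, mem_univ, true_and, hcomm.mul_pow, hyu]
    have hz' : ∀ {m}, s ∣ m → z ^ m = 1 := fun ⟨t, ht⟩ ↦ by rw [ht, pow_mul, hzs, one_pow]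
    rw [hz' hu', hz' (dvd_mul_left _ _), hz' (dvd_mul_left _ _), mul_one, mul_one, mul_one]
    refine ⟨⟨?_, fun h ↦ ?_⟩, rfl⟩
    · rw [← hy, pow_mul, pow_orderOf_eq_one, one_pow]
    · have := hy ▸ orderOf_dvd_of_pow_eq_one h
      have := (Nat.Coprime.pow_left (k + 1) hs).dvd_of_dvd_mul_right this
      exact absurd ((Nat.pow_dvd_pow_iff_le_right hp.out.one_lt).1 this) (by omega)

end

/-- If `y` has order coprime to `s` and Frobenius's theorem holds for `centralizer {y} ⧸ ⟨y⟩`,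
then `s` divides the contribution of the conjugacy class of `y`. -/
lemma dvd_index_centralizer_mul_card {G : Type*} [Group G] [Finite G] {s : ℕ} {y : G}
    (ih : ∀ (Z : Subgroup (centralizer {y})) [Z.Normal], Nat.card Z = orderOf y → ∀ n : ℕ,
      n ∣ Nat.card (centralizer {y} ⧸ Z) →
        n ∣ Nat.card {x : centralizer {y} ⧸ Z // x ^ n = 1})
    (hs : (orderOf y).Coprime s) (hdvd : s ∣ Nat.card G) :
    s ∣ (centralizer {y}).index * Nat.card {z : centralizer {y} // z ^ s = 1} := by
  let y' : centralizer {y} := ⟨y, mem_centralizer_singleton_iff.2 rfl⟩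
  let Z := zpowers y'
  have hZ : Z ≤ center (centralizer {y}) := by
    refine zpowers_le.2 (mem_center_iff.2 fun z ↦ Subtype.ext ?_)
    exact mem_centralizer_singleton_iff.1 z.2
  have : Z.Normal := ⟨fun z hz g ↦ by rwa [mem_center_iff.1 (hZ hz) g, mul_inv_cancel_right]⟩
  have hcard : Nat.card Z = orderOf y := by rw [Nat.card_zpowers, orderOf_mk]
  have hq := ih Z hcard (s.gcd (Nat.card (centralizer {y} ⧸ Z))) (Nat.gcd_dvd_right _ _)
  simp only [pow_gcd_natCard_eq_one_iff] at hq
  rw [card_pow_eq_one_quotient_of_le_center Z hZ (hcard ▸ hs)]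
  refine dvd_trans ?_ (mul_dvd_mul_left _ hq)
  rw [← Nat.gcd_mul_left]
  refine Nat.dvd_gcd (dvd_mul_left _ _) (hs.symm.dvd_of_dvd_mul_right ?_)
  rwa [mul_assoc, ← hcard, ← card_eq_card_quotient_mul_card_subgroup, index_mul_card]

lemma dvd_natCard_pow_eq_one (N : ℕ) : ∀ (G : Type*) [Group G] [Finite G], Nat.card G = N →
    ∀ m n : ℕ, Nat.card G = n * m → n ∣ Nat.card {x : G // x ^ n = 1} := by
  classical
  induction N using Nat.strong_induction_on with
  | _ N ihN =>
  intro G _ _ hN m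
  induction m using Nat.strong_induction_on with
  | _ m ihm =>
  intro n hn
  have : Fintype G := Fintype.ofFinite G
  have hpos : 0 < n * m := hn ▸ Nat.card_pos
  have hn0 : n ≠ 0 := by rintro rfl; simp at hpos
  rcases eq_or_ne m 1 with rfl | hm
  · rw [mul_one] at hn
    simp [← hn]
  obtain ⟨p, hp, m', rfl⟩ := Nat.exists_prime_and_dvd hm
  have := Fact.mk hp
  obtain ⟨k, s, hps, rfl⟩ := Nat.exists_eq_pow_mul_and_not_dvd hn0 p hp.ne_one
  have hcop : p.Coprime s := (Nat.Prime.coprime_iff_not_dvd hp).2 hps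
  have hm' : 0 < m' := by
    rcases Nat.eq_zero_or_pos m' with rfl | h
    · simp at hpos
    · exact h
  have hnp := ihm m' (lt_mul_of_one_lt_left hm' hp.one_lt) (p ^ (k + 1) * s)
    (by rw [hn]; ring)
  set S : Finset G := {x : G | x ^ (p ^ (k + 1) * s) = 1 ∧ x ^ (p ^ k * s) ≠ 1} with hS
  have hle : ∀ x : G, x ^ (p ^ k * s) = 1 → x ^ (p ^ (k + 1) * s) = 1 := fun x hx ↦ by
    rw [pow_succ, mul_right_comm, pow_mul, hx, one_pow]
  have hsum : Nat.card {x : G // x ^ (p ^ (k + 1) * s) = 1} =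
      Nat.card {x : G // x ^ (p ^ k * s) = 1} + #S := by
    simp only [Nat.card_eq_fintype_card, Fintype.card_subtype]
    rw [← card_filter_add_card_filter_not (s := {x : G | x ^ (p ^ (k + 1) * s) = 1})
      (fun x ↦ x ^ (p ^ k * s) = 1), filter_filter, filter_filter]
    congr 2
    ext x
    simpa using hle x
  obtain ⟨u, hu, hu'⟩ := Nat.chineseRemainder (hcop.pow_left (k + 1)) 1 0
  replace hu' : s ∣ u := (Nat.modEq_zero_iff_dvd).1 hu'
  suffices p ^ k * s ∣ #S by
    refine (Nat.dvd_add_left this).1 (hsum ▸ dvd_trans ?_ hnp)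
    exact mul_dvd_mul_right (pow_dvd_pow p (Nat.le_succ k)) s
  refine (hcop.pow_left k).mul_dvd_of_dvd_of_dvd ?_ ?_
  · refine dvd_card_of_dvd_totient_orderOf S (fun x y hxy hx ↦ ?_) fun x hx ↦ ?_
    · have hord : orderOf x = orderOf y := by rw [← Nat.card_zpowers, hxy, Nat.card_zpowers]
      simpa only [hS, mem_filter_univ, ← orderOf_dvd_iff_pow_eq_one, ne_eq, hord] using hx
    · rw [hS, mem_filter_univ] at hx
      have h := orderOf_pow_dvd (x := x) u
      rw [orderOf_pow_eq_prime_pow hx.1 hx.2 hu hu'] at h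
      refine dvd_trans ?_ (Nat.totient_dvd_of_dvd h)
      rw [Nat.totient_prime_pow_succ hp]
      exact dvd_mul_right _ _
  · rw [card_eq_sum_card_fiberwise (f := fun x ↦ x ^ u) (t := univ) (by simp [Set.MapsTo])]
    refine dvd_sum_of_dvd_index_centralizer_mul _ (fun y y' hyy' ↦ ?_) fun y ↦ ?_
    · obtain ⟨g, rfl⟩ := isConj_iff.1 hyy'
      refine card_equiv (MulAut.conj g).toEquiv fun x ↦ ?_
      simp [hS, conj_pow]
    · rcases Finset.eq_empty_or_nonempty {x ∈ S | x ^ u = y} with h | ⟨x, hx⟩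
      · simp [h]
      obtain ⟨hx, hxy⟩ := mem_filter.1 hx
      rw [hS, mem_filter_univ] at hx
      have hy : orderOf y = p ^ (k + 1) := hxy ▸ orderOf_pow_eq_prime_pow hx.1 hx.2 hu hu'
      rw [card_filter_pow_eq_card_centralizer hu hu' hcop hy]
      refine dvd_index_centralizer_mul_card (fun Z _ hZ n hn ↦ ?_)
        (hy ▸ hcop.pow_left (k + 1)) ⟨p ^ k * (p * m'), by rw [hn]; ring⟩
      obtain ⟨l, hl⟩ := hn
      refine ihN _ ?_ _ rfl l n hl
      have h1 : 1 < Nat.card Z := by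
        rw [hZ, hy]
        exact Nat.one_lt_pow (Nat.succ_ne_zero k) hp.one_lt
      calc Nat.card (centralizer {y} ⧸ Z)
          < Nat.card (centralizer {y} ⧸ Z) * Nat.card Z := lt_mul_of_one_lt_right Nat.card_pos h1
        _ = Nat.card (centralizer {y}) := (card_eq_card_quotient_mul_card_subgroup Z).symm
        _ ≤ N := hN ▸ Nat.card_le_card_of_injective _ Subtype.val_injective

/-- Frobenius's theorem: if `H` is a finite group and `n` divides `|H|`, then the
number of elements `x ∈ H` with `x ^ n = 1` is a multiple of `n`. -/
theorem frobenius_divisibility (H : Type*) [Group H] [Fintype H] (n : ℕ) (hn : 0 < n)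
    (hdvd : n ∣ Fintype.card H) :
    n ∣ Nat.card {x : H // x ^ n = 1} := by
  obtain ⟨m, hm⟩ := hdvd
  exact dvd_natCard_pow_eq_one _ H rfl m n (by rw [Nat.card_eq_fintype_card, hm])
end

section
/- The number of pairs (A, B) of commuting elements of GL_n(F_q) such that the order of A is prime to p equals |GL_n(F_q)| times the number of monic polynomials of degree n over F_q with nonzero constant term, i.e., |GL_n(F_q)| * q^{n-1} * (q - 1). -/
open Polynomial Module

section Semisimple

variable {K V V' : Type*} [Field K] [AddCommGroup V] [Module K V]
  [AddCommGroup V'] [Module K V']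

/-- The irreducible factors of the characteristic polynomial divide the minimal polynomial. -/
theorem Irreducible.dvd_minpoly_of_dvd_charpoly [FiniteDimensional K V] {f : End K V}
    {r : K[X]} (hr : Irreducible r)
    (h : r ∣ f.charpoly) : r ∣ minpoly K f := by
  have : Fact (Irreducible r) := ⟨hr⟩
  let L := AdjoinRoot r
  let g : End L (TensorProduct K L V) := End.baseChangeHom K L V f
  have hroot : g.charpoly.IsRoot (AdjoinRoot.root r) := by
    obtain ⟨s, hs⟩ := h
    have : g.charpoly = f.charpoly.map (algebraMap K L) := LinearMap.charpoly_baseChange (f := f) L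
    rw [this, hs, IsRoot.def, eval_map_algebraMap, map_mul, AdjoinRoot.aeval_eq,
      AdjoinRoot.mk_self, zero_mul]
  rw [← End.hasEigenvalue_iff_isRoot_charpoly, End.hasEigenvalue_iff_isRoot] at hroot
  have hdvd : minpoly L g ∣ (minpoly K f).map (algebraMap K L) := by
    refine minpoly.dvd L g ?_
    rw [aeval_map_algebraMap, aeval_algHom_apply, minpoly.aeval, map_zero]
  have := hroot.dvd hdvd
  rwa [IsRoot.def, eval_map_algebraMap, AdjoinRoot.aeval_eq, AdjoinRoot.mk_eq_zero] at this

theorem Irreducible.exists_ne_zero_aeval_apply_eq_zero [FiniteDimensional K V] {f : End K V}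
    {r : K[X]} (hr : Irreducible r) (h : r ∣ f.charpoly) : ∃ v, v ≠ 0 ∧ aeval f r v = 0 := by
  by_contra! hv
  obtain ⟨s, hs⟩ := hr.dvd_minpoly_of_dvd_charpoly h
  have hs0 : s ≠ 0 := by
    rintro rfl
    exact minpoly.ne_zero_of_finite K f (by rw [hs, mul_zero])
  have hsf : aeval f s = 0 := by
    ext v
    by_contra hsv
    refine hv _ hsv ?_
    rw [← End.mul_apply, ← map_mul, ← hs, minpoly.aeval, LinearMap.zero_apply]
  have hdeg := natDegree_le_of_dvd (minpoly.dvd K f hsf) hs0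
  rw [hs, natDegree_mul hr.ne_zero hs0] at hdeg
  have := hr.natDegree_pos
  omega

/-- The `K`-linear map `K[X] → V` sending `r` to `r(f) v`. -/
noncomputable def orbitMap (f : End K V) (v : V) : K[X] →ₗ[K] V :=
  (LinearMap.applyₗ v).comp (aeval f).toLinearMap

theorem orbitMap_apply (f : End K V) (v : V) (r : K[X]) : orbitMap f v r = aeval f r v := rfl

theorem orbitMap_X_mul (f : End K V) (v : V) (r : K[X]) :
    orbitMap f v (X * r) = f (orbitMap f v r) := by
  simp [orbitMap_apply]

theorem range_orbitMap_mem_invtSubmodule (f : End K V) (v : V) :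
    LinearMap.range (orbitMap f v) ∈ f.invtSubmodule := by
  rw [End.mem_invtSubmodule]
  rintro _ ⟨r, rfl⟩
  exact ⟨X * r, orbitMap_X_mul f v r⟩

theorem Irreducible.mem_ker_orbitMap_iff {f : End K V} {v : V} {r : K[X]} (hr : Irreducible r)
    (hv : v ≠ 0) (h : aeval f r v = 0) (s : K[X]) :
    s ∈ LinearMap.ker (orbitMap f v) ↔ r ∣ s := by
  rw [LinearMap.mem_ker, orbitMap_apply]
  constructor
  · intro hs
    by_contra hrs
    obtain ⟨a, b, hab⟩ := hr.coprime_iff_not_dvd.2 hrs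
    apply hv
    have := congrArg (fun t => aeval f t v) hab
    simpa [h, hs] using this.symm
  · rintro ⟨t, rfl⟩
    rw [mul_comm, map_mul, End.mul_apply, h, map_zero]

/-- Endomorphisms `f` and `g` of vector spaces are conjugate if a linear isomorphism
intertwines them. -/
def LinearMap.IsConjugate (f : End K V) (g : End K V') : Prop :=
  ∃ e : V ≃ₗ[K] V', ∀ x, e (f x) = g (e x)

theorem LinearMap.IsConjugate.charpoly_eq [FiniteDimensional K V] [FiniteDimensional K V']
    {f : End K V} {g : End K V'} (h : LinearMap.IsConjugate f g) : f.charpoly = g.charpoly := by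
  obtain ⟨e, he⟩ := h
  rw [← e.charpoly_conj f]
  congr 1
  ext x
  simp [LinearEquiv.conj_apply, he]

theorem Irreducible.isConjugate_restrict_range_orbitMap {f : End K V} {g : End K V'} {v : V}
    {w : V'} {r : K[X]} (hr : Irreducible r) (hv : v ≠ 0) (hw : w ≠ 0) (hfv : aeval f r v = 0)
    (hgw : aeval g r w = 0) :
    LinearMap.IsConjugate (f.restrict (range_orbitMap_mem_invtSubmodule f v))
      (g.restrict (range_orbitMap_mem_invtSubmodule g w)) := by
  have hker : LinearMap.ker (orbitMap f v) = LinearMap.ker (orbitMap g w) := by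
    ext s
    rw [hr.mem_ker_orbitMap_iff hv hfv, hr.mem_ker_orbitMap_iff hw hgw]
  let e := (orbitMap f v).quotKerEquivRange.symm ≪≫ₗ Submodule.quotEquivOfEq _ _ hker ≪≫ₗ
    (orbitMap g w).quotKerEquivRange
  have he (s : K[X]) : e ⟨orbitMap f v s, s, rfl⟩ = ⟨orbitMap g w s, s, rfl⟩ := by
    have : (⟨orbitMap f v s, s, rfl⟩ : LinearMap.range (orbitMap f v)) =
        (orbitMap f v).quotKerEquivRange (Submodule.Quotient.mk s) := rfl
    rw [this]
    simp only [e, LinearEquiv.trans_apply, LinearEquiv.symm_apply_apply]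
    rfl
  refine ⟨e, ?_⟩
  rintro ⟨_, s, rfl⟩
  have hfs : f.restrict (p := LinearMap.range (orbitMap f v))
      (q := LinearMap.range (orbitMap f v)) (range_orbitMap_mem_invtSubmodule f v)
      ⟨orbitMap f v s, s, rfl⟩ = (⟨orbitMap f v (X * s), X * s, rfl⟩ : LinearMap.range (orbitMap f v)) :=
    Subtype.ext (orbitMap_X_mul f v s).symm
  rw [hfs, he, he]
  exact Subtype.ext (orbitMap_X_mul g w s)

theorem LinearMap.isConjugate_prodMap_restrict {f : End K V} {p q : Submodule K V}
    (hp : p ∈ f.invtSubmodule) (hq : q ∈ f.invtSubmodule) (h : IsCompl p q) :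
    LinearMap.IsConjugate ((f.restrict hp).prodMap (f.restrict hq)) f :=
  ⟨Submodule.prodEquivOfIsCompl p q h, fun x => by
    rw [Submodule.coe_prodEquivOfIsCompl', Submodule.coe_prodEquivOfIsCompl', map_add]
    rfl⟩

theorem LinearMap.IsConjugate.prodMap {W W' : Type*} [AddCommGroup W] [Module K W]
    [AddCommGroup W'] [Module K W'] {f : End K V} {f' : End K V'} {g : End K W} {g' : End K W'}
    (hf : LinearMap.IsConjugate f f') (hg : LinearMap.IsConjugate g g') :
    LinearMap.IsConjugate (f.prodMap g) (f'.prodMap g') := by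
  obtain ⟨e, he⟩ := hf
  obtain ⟨d, hd⟩ := hg
  exact ⟨e.prodCongr d, fun x => by simp [he, hd]⟩

theorem LinearMap.IsConjugate.symm {f : End K V} {g : End K V'} (h : LinearMap.IsConjugate f g) :
    LinearMap.IsConjugate g f := by
  obtain ⟨e, he⟩ := h
  exact ⟨e.symm, fun x => e.injective (by simp [he])⟩

theorem LinearMap.IsConjugate.trans {V'' : Type*} [AddCommGroup V''] [Module K V'']
    {f : End K V} {g : End K V'} {h : End K V''}
    (hfg : LinearMap.IsConjugate f g) (hgh : LinearMap.IsConjugate g h) :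
    LinearMap.IsConjugate f h := by
  obtain ⟨e, he⟩ := hfg
  obtain ⟨d, hd⟩ := hgh
  exact ⟨e.trans d, fun x => by simp [he, hd]⟩

end Semisimple

/-- Semisimple endomorphisms with the same characteristic polynomial are conjugate. -/
theorem Module.End.IsSemisimple.isConjugate_of_charpoly_eq {K V V' : Type*} [Field K]
    [AddCommGroup V] [Module K V] [FiniteDimensional K V]
    [AddCommGroup V'] [Module K V'] [FiniteDimensional K V'] {f : End K V} {g : End K V'}
    (hf : f.IsSemisimple) (hg : g.IsSemisimple) (h : f.charpoly = g.charpoly) :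
    LinearMap.IsConjugate f g := by
  induction hN : finrank K V using Nat.strong_induction_on generalizing V V' with
  | _ N ih =>
  have hdim : finrank K V = finrank K V' := by
    rw [← f.charpoly_natDegree, h, g.charpoly_natDegree]
  obtain hN0 | hN0 := Nat.eq_zero_or_pos N
  · have := finrank_zero_iff.1 (hN.trans hN0)
    have := finrank_zero_iff.1 (hdim.symm.trans (hN.trans hN0))
    exact ⟨LinearEquiv.ofFinrankEq V V' hdim, fun x => Subsingleton.elim _ _⟩
  obtain ⟨r, hr, hrf⟩ := exists_irreducible_of_natDegree_pos (f := f.charpoly)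
    (by rw [f.charpoly_natDegree]; omega)
  obtain ⟨v, hv, hfv⟩ := hr.exists_ne_zero_aeval_apply_eq_zero hrf
  obtain ⟨w, hw, hgw⟩ := hr.exists_ne_zero_aeval_apply_eq_zero (h ▸ hrf)
  have hp := range_orbitMap_mem_invtSubmodule f v
  have hp' := range_orbitMap_mem_invtSubmodule g w
  have hpp := hr.isConjugate_restrict_range_orbitMap hv hw hfv hgw
  obtain ⟨q, hq, hpq⟩ := isSemisimple_iff.1 hf _ hp
  obtain ⟨q', hq', hpq'⟩ := isSemisimple_iff.1 hg _ hp'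
  have hdec := LinearMap.isConjugate_prodMap_restrict hp hq hpq
  have hdec' := LinearMap.isConjugate_prodMap_restrict hp' hq' hpq'
  have hchar : (f.restrict hq).charpoly = (g.restrict hq').charpoly := by
    rw [← hdec.charpoly_eq, ← hdec'.charpoly_eq, LinearMap.charpoly_prodMap,
      LinearMap.charpoly_prodMap, hpp.charpoly_eq] at h
    exact mul_left_cancel₀ (LinearMap.charpoly_monic _).ne_zero h
  have hlt : finrank K q < N := by
    have : Nontrivial (LinearMap.range (orbitMap f v)) :=
      ⟨⟨⟨v, 1, by simp [orbitMap_apply]⟩, 0, fun h0 => hv (congrArg Subtype.val h0)⟩⟩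
    have hsum := Submodule.finrank_add_eq_of_isCompl hpq
    have hpos : 0 < finrank K (LinearMap.range (orbitMap f v)) := finrank_pos
    omega
  exact hdec.symm.trans ((hpp.prodMap
    (ih _ hlt (hf.restrict hq) (hg.restrict hq') hchar rfl)).trans hdec')

/-- If `χ` separates the conjugacy classes inside a conjugation-invariant set `S`, then the
commuting pairs with first entry in `S` number `|G|` times the number of values of `χ` on `S`. -/
theorem card_commute_fst_mem {G X : Type*} [Group G] (S : Set G) (χ : G → X)
    (hS : ∀ a b, IsConj a b → a ∈ S → b ∈ S)
    (hχ : ∀ a ∈ S, ∀ b ∈ S, IsConj a b ↔ χ a = χ b) :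
    Nat.card {ab : G × G // Commute ab.1 ab.2 ∧ ab.1 ∈ S} =
      Nat.card G * Nat.card (χ '' S) := by
  let T : SubMulAction (ConjAct G) G :=
    { carrier := S
      smul_mem' := fun c a ha => hS a _ (isConj_iff.2 ⟨ConjAct.ofConjAct c, rfl⟩) ha }
  have hrel (a b : T) : MulAction.orbitRel (ConjAct G) T a b ↔ χ a = χ b := by
    rw [← hχ a a.2 b b.2, isConj_comm, isConj_iff, MulAction.orbitRel_apply, MulAction.mem_orbit_iff]
    constructor
    · rintro ⟨c, hc⟩
      exact ⟨ConjAct.ofConjAct c, congrArg Subtype.val hc⟩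
    · rintro ⟨c, hc⟩
      exact ⟨ConjAct.toConjAct c, Subtype.ext hc⟩
  let e₁ : Quotient (MulAction.orbitRel (ConjAct G) T) ≃ χ '' S :=
    Equiv.ofBijective
      (Quotient.lift (fun a : T => (⟨χ a, a, a.2, rfl⟩ : χ '' S))
        fun a b hab => Subtype.ext ((hrel a b).1 hab))
      ⟨by
        rintro ⟨a⟩ ⟨b⟩ hab
        exact Quotient.sound ((hrel a b).2 (congrArg Subtype.val hab)), by
        rintro ⟨_, a, ha, rfl⟩
        exact ⟨Quotient.mk _ ⟨a, ha⟩, rfl⟩⟩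
  let e₂ : {ab : G × G // Commute ab.1 ab.2 ∧ ab.1 ∈ S} ≃
      Σ c : ConjAct G, MulAction.fixedBy T c :=
    { toFun := fun ab => ⟨ConjAct.toConjAct ab.1.2, ⟨ab.1.1, ab.2.2⟩, Subtype.ext <|
        mul_inv_eq_of_eq_mul ab.2.1.eq.symm⟩
      invFun := fun x => ⟨(x.2.1.1, ConjAct.ofConjAct x.1),
        (mul_inv_eq_iff_eq_mul.1 (congrArg Subtype.val x.2.2)).symm, x.2.1.2⟩
      left_inv := fun _ => rfl
      right_inv := fun _ => rfl }
  rw [Nat.card_congr (e₂.trans ((MulAction.sigmaFixedByEquivOrbitsProdGroup (ConjAct G) T).trans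
    (e₁.prodCongr ConjAct.ofConjAct.toEquiv))), Nat.card_prod, mul_comm]

/-- The number of monic polynomials of degree `m + 1` with nonzero constant term. -/
theorem card_monic_natDegree_eq_coeff_zero_ne (F : Type*) [Field F] [Fintype F] (m : ℕ) :
    Nat.card {f : F[X] | (f.Monic ∧ f.natDegree = m + 1) ∧ f.coeff 0 ≠ 0} =
      Fintype.card F ^ m * (Fintype.card F - 1) := by
  let e := (monicEquivDegreeLT (R := F) (m + 1)).trans (degreeLTEquiv F (m + 1)).toEquiv
  have he (f) : e f 0 = f.1.coeff 0 := by
    obtain ⟨f, hf, hdeg⟩ := f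
    change f.eraseLead.coeff 0 = f.coeff 0
    exact eraseLead_coeff_of_ne _ (by omega)
  let e₁ : {f : F[X] | (f.Monic ∧ f.natDegree = m + 1) ∧ f.coeff 0 ≠ 0} ≃
      {c : Fin (m + 1) → F // c 0 ≠ 0} :=
    (Equiv.subtypeSubtypeEquivSubtypeInter (fun f : F[X] => f.Monic ∧ f.natDegree = m + 1)
      (fun f => f.coeff 0 ≠ 0)).symm.trans (e.subtypeEquiv fun f => by rw [he])
  let e₂ : {c : Fin (m + 1) → F // c 0 ≠ 0} ≃ Fˣ × (Fin m → F) :=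
    { toFun := fun c => (Units.mk0 _ c.2, Fin.tail c.1)
      invFun := fun x => ⟨Fin.cons x.1.1 x.2, x.1.ne_zero⟩
      left_inv := fun c => Subtype.ext (Fin.cons_self_tail c.1)
      right_inv := fun x => by ext <;> simp }
  rw [Nat.card_congr (e₁.trans e₂), Nat.card_prod, Nat.card_units, Nat.card_eq_fintype_card,
    Nat.card_eq_fintype_card, Fintype.card_fun, Fintype.card_fin, mul_comm]

theorem Matrix.exists_charpoly_eq {F : Type*} [Field F] {n : ℕ} {f : F[X]}
    (hf : f.Monic) (hn : f.natDegree = n) : ∃ M : Matrix (Fin n) (Fin n) F, M.charpoly = f := by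
  subst hn
  let B := AdjoinRoot.powerBasis hf.ne_zero
  exact ⟨Algebra.leftMulMatrix B.basis B.gen,
    (charpoly_leftMulMatrix B).trans (AdjoinRoot.minpoly_powerBasis_gen_of_monic hf)⟩

/-- If `p ∣ q`, some iterated `q`-th power of an element of finite order has order prime to `p`. -/
theorem exists_coprime_orderOf_pow_pow {G : Type*} [Monoid G] {p q : ℕ} (hp : p.Prime)
    (hpq : p ∣ q) {a : G} (ha : IsOfFinOrder a) : ∃ k, (orderOf (a ^ q ^ k)).Coprime p := by
  obtain ⟨k, m, hm, hk⟩ := Nat.exists_eq_pow_mul_and_not_dvd ha.orderOf_pos.ne' p hp.ne_one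
  refine ⟨k, Nat.Coprime.coprime_dvd_left ?_ ((Nat.Prime.coprime_iff_not_dvd hp).2 hm).symm⟩
  rw [orderOf_dvd_iff_pow_eq_one, ← pow_mul, ← orderOf_dvd_iff_pow_eq_one, hk]
  exact mul_dvd_mul_right (pow_dvd_pow_of_dvd hpq k) m

theorem FiniteField.charpoly_pow_card_pow {F ι : Type*} [Field F] [Fintype F] [Fintype ι]
    [DecidableEq ι] (M : Matrix ι ι F) (k : ℕ) :
    (M ^ Fintype.card F ^ k).charpoly = M.charpoly := by
  induction k with
  | zero => simp
  | succ k ih => rw [pow_succ, pow_mul, FiniteField.Matrix.charpoly_pow_card, ih]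

theorem Matrix.isSemisimple_toLin'_of_coprime_orderOf {F ι : Type*} [Field F] [Fintype ι]
    [DecidableEq ι] (p : ℕ) [CharP F p] (hp : p.Prime) {M : Matrix ι ι F}
    (hM : (orderOf M).Coprime p) : Module.End.IsSemisimple (Matrix.toLin' M) := by
  refine Module.End.isSemisimple_of_squarefree_aeval_eq_zero (p := X ^ orderOf M - 1) ?_ ?_
  · refine (X_pow_sub_one_separable_iff.2 fun h => ?_).squarefree
    exact hp.coprime_iff_not_dvd.1 hM.symm ((CharP.cast_eq_zero_iff F p _).1 h)
  · rw [map_sub, map_pow, aeval_X, map_one, ← Matrix.toLin'_pow, pow_orderOf_eq_one,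
      Matrix.toLin'_one, End.one_eq_id, sub_self]

theorem Matrix.GeneralLinearGroup.isConj_iff_charpoly_eq {F ι : Type*} [Field F] [Fintype ι]
    [DecidableEq ι] (p : ℕ) [CharP F p] (hp : p.Prime) {A B : GL ι F}
    (hA : (orderOf A).Coprime p) (hB : (orderOf B).Coprime p) :
    IsConj A B ↔ A.1.charpoly = B.1.charpoly := by
  constructor
  · rw [isConj_iff]
    rintro ⟨P, rfl⟩
    rw [Units.val_mul, Units.val_mul, Matrix.coe_units_inv, Matrix.charpoly_units_conj]
  · intro h
    rw [← orderOf_units] at hA hB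
    obtain ⟨e, he⟩ := (isSemisimple_toLin'_of_coprime_orderOf p hp hA).isConjugate_of_charpoly_eq
      (isSemisimple_toLin'_of_coprime_orderOf p hp hB) (by simpa using h)
    let P : GL ι F := ⟨LinearMap.toMatrix' e.toLinearMap, LinearMap.toMatrix' e.symm.toLinearMap,
      by rw [← LinearMap.toMatrix'_comp]; simp, by rw [← LinearMap.toMatrix'_comp]; simp⟩
    refine isConj_iff.2 ⟨P, mul_inv_eq_of_eq_mul (Units.ext ?_)⟩
    apply Matrix.toLin'.injective
    ext1 i
    ext1
    simpa [P, Matrix.toLin'_mul] using he (Pi.single i 1)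

/-- The characteristic polynomials of the elements of `GL_n(F)` of order prime to `p` are the monic
polynomials of degree `n` with nonzero constant term. -/
theorem Matrix.GeneralLinearGroup.image_charpoly_coprime_orderOf {F : Type*} [Field F] [Fintype F]
    (p : ℕ) [CharP F p] (hp : p.Prime) (n : ℕ) :
    (fun A : GL (Fin n) F => A.1.charpoly) '' {A | (orderOf A).Coprime p} =
      {f : F[X] | (f.Monic ∧ f.natDegree = n) ∧ f.coeff 0 ≠ 0} := by
  ext f
  constructor
  · rintro ⟨A, -, rfl⟩
    refine ⟨⟨Matrix.charpoly_monic _, by simp [Matrix.charpoly_natDegree_eq_dim]⟩, fun h => ?_⟩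
    have := A.1.det_eq_sign_charpoly_coeff
    rw [h, mul_zero] at this
    exact A.det_ne_zero this
  · rintro ⟨⟨hf, hn⟩, h0⟩
    obtain ⟨M, rfl⟩ := Matrix.exists_charpoly_eq hf hn
    have hdet : M.det ≠ 0 := by
      rw [M.det_eq_sign_charpoly_coeff]
      exact mul_ne_zero (pow_ne_zero _ (by simp)) h0
    have hdvd : p ∣ Fintype.card F := by
      rw [← CharP.cast_eq_zero_iff F p, Nat.cast_card_eq_zero]
    obtain ⟨k, hk⟩ := exists_coprime_orderOf_pow_pow hp hdvd
      (isOfFinOrder_of_finite (Matrix.GeneralLinearGroup.mkOfDetNeZero M hdet))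
    exact ⟨_, hk, FiniteField.charpoly_pow_card_pow M k⟩


/-- The number of pairs `(A, B)` of commuting elements of `GL_n(F_q)` with the order of
`A` prime to `p` equals `|GL_n(F_q)| * q^{n-1} * (q - 1)`. -/
theorem card_commuting_pairs_first_semisimple
    (p : ℕ) (hp : p.Prime) (F : Type*) [Field F] [Fintype F] [CharP F p]
    (q : ℕ) (hq : Fintype.card F = q) (n : ℕ) (hn : 0 < n) :
    Nat.card {AB : GL (Fin n) F × GL (Fin n) F //
        Commute AB.1 AB.2 ∧ Nat.Coprime (orderOf AB.1) p} =
      Nat.card (GL (Fin n) F) * (q ^ (n - 1) * (q - 1)) := by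
  obtain ⟨m, rfl⟩ := Nat.exists_eq_succ_of_ne_zero hn.ne'
  subst hq
  have h := card_commute_fst_mem {A : GL (Fin (m + 1)) F | (orderOf A).Coprime p}
    (fun A => A.1.charpoly)
    (fun A B hAB hA => by
      obtain ⟨P, rfl⟩ := isConj_iff.1 hAB
      have : orderOf (P * A * P⁻¹) = orderOf A := MulEquiv.orderOf_eq (MulAut.conj P) A
      rwa [Set.mem_ofPred_eq, this])
    (fun A hA B hB => Matrix.GeneralLinearGroup.isConj_iff_charpoly_eq p hp hA hB)
  rw [Matrix.GeneralLinearGroup.image_charpoly_coprime_orderOf p hp] at h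
  exact h.trans (congrArg _ (card_monic_natDegree_eq_coeff_zero_ne F m))
end

section
/- The number of ordered pairs (X, Y) of commuting semisimple matrices in GL_2(F_q) equals q^6 - 2q^5 - q^4 + 4q^3 - q^2 - 2q + 1, i.e., |GL_2(F_q)| * (q^3 - q^2 - q + 1)/q. -/
namespace Matrix

section TwoByTwo

variable {F : Type*} [Field F]

theorem mem_range_scalar_fin_two_iff {X : Matrix (Fin 2) (Fin 2) F} :
    X ∈ Set.range (scalar (Fin 2)) ↔ X 0 0 = X 1 1 ∧ X 0 1 = 0 ∧ X 1 0 = 0 := by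
  constructor
  · rintro ⟨a, rfl⟩
    simp
  · rintro ⟨h, h₁, h₂⟩
    refine ⟨X 0 0, ?_⟩
    ext i j
    fin_cases i <;> fin_cases j <;> simp [h, h₁, h₂]

theorem discr_scalar_add_smul (X : Matrix (Fin 2) (Fin 2) F) (u v : F) :
    (scalar (Fin 2) u + v • X).discr = v ^ 2 * X.discr := by
  simp only [discr_fin_two, trace_fin_two, det_fin_two, add_apply, smul_apply, scalar_apply]
  simp
  ring

theorem discr_eq_zero_of_mem_range_scalar {X : Matrix (Fin 2) (Fin 2) F}
    (h : X ∈ Set.range (scalar (Fin 2))) : X.discr = 0 := by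
  rw [mem_range_scalar_fin_two_iff] at h
  simp only [discr_fin_two, trace_fin_two, det_fin_two, h]
  ring

/-- The centralizer of a nonscalar `2 × 2` matrix `X` consists of the polynomials in `X`. -/
theorem exists_eq_scalar_add_smul_of_commute {X Y : Matrix (Fin 2) (Fin 2) F}
    (hX : X ∉ Set.range (scalar (Fin 2))) (h : Commute X Y) :
    ∃ u v : F, Y = scalar (Fin 2) u + v • X := by
  have h00 := congr_fun₂ h.eq 0 0
  have h01 := congr_fun₂ h.eq 0 1
  have h10 := congr_fun₂ h.eq 1 0
  simp only [mul_apply, Fin.sum_univ_two] at h00 h01 h10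
  suffices ∃ v : F, Y 0 0 - v * X 0 0 = Y 1 1 - v * X 1 1 ∧ Y 0 1 = v * X 0 1 ∧
      Y 1 0 = v * X 1 0 by
    obtain ⟨v, hd, h₁, h₂⟩ := this
    refine ⟨Y 0 0 - v * X 0 0, v, ?_⟩
    ext i j
    fin_cases i <;> fin_cases j
    · simp
    · simp [h₁]
    · simp [h₂]
    · simp [hd]
  by_cases hb : X 0 1 = 0
  · by_cases hc : X 1 0 = 0
    · have hd : X 0 0 - X 1 1 ≠ 0 := fun hd ↦
        hX (mem_range_scalar_fin_two_iff.2 ⟨sub_eq_zero.1 hd, hb, hc⟩)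
      refine ⟨(Y 0 0 - Y 1 1) / (X 0 0 - X 1 1), ?_, ?_, ?_⟩
      · field_simp
        ring
      · rw [hb, mul_zero]
        exact (mul_eq_zero.1 (by rw [hb] at h01; linear_combination h01)).resolve_left hd
      · rw [hc, mul_zero]
        exact (mul_eq_zero.1 (by rw [hc] at h10; linear_combination -h10)).resolve_left hd
    · refine ⟨Y 1 0 / X 1 0, ?_, ?_, ?_⟩ <;> field_simp <;> grind
  · refine ⟨Y 0 1 / X 0 1, ?_, ?_, ?_⟩ <;> field_simp <;> grind

theorem sq_eq_zero_of_trace_of_det {N : Matrix (Fin 2) (Fin 2) F}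
    (ht : N.trace = 0) (hd : N.det = 0) : N ^ 2 = 0 := by
  rw [trace_fin_two] at ht
  rw [det_fin_two] at hd
  rw [sq]
  ext i j
  fin_cases i <;> fin_cases j <;> simp [mul_apply, Fin.sum_univ_two] <;> grind

theorem exists_trace_det_sub_scalar_eq_zero [Finite F] {X : Matrix (Fin 2) (Fin 2) F}
    (hX : X.discr = 0) :
    ∃ a : F, (X - scalar (Fin 2) a).trace = 0 ∧ (X - scalar (Fin 2) a).det = 0 := by
  simp only [discr_fin_two, trace_fin_two, det_fin_two] at hX
  have (a : F) : (X - scalar (Fin 2) a).trace = X 0 0 + X 1 1 - 2 * a ∧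
      (X - scalar (Fin 2) a).det = (X 0 0 - a) * (X 1 1 - a) - X 0 1 * X 1 0 := by
    simp [trace_fin_two, det_fin_two]
  simp only [this]
  by_cases h2 : (2 : F) = 0
  · obtain ⟨a, ha⟩ := FiniteField.isSquare_of_char_two
      (CharP.ringChar_of_prime_eq_zero Nat.prime_two (by exact_mod_cast h2)) X.det
    rw [det_fin_two] at ha
    refine ⟨a, ?_⟩
    have : X 0 0 - X 1 1 = 0 := by
      refine pow_eq_zero_iff two_ne_zero |>.1 ?_
      linear_combination hX - 2 * X 0 1 * X 1 0 * h2
    grind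
  · refine ⟨(X 0 0 + X 1 1) / 2, ?_, ?_⟩
    · field_simp
      ring
    · field_simp
      linear_combination -hX

theorem discr_eq_zero_of_isNilpotent {N : Matrix (Fin 2) (Fin 2) F}
    (hN : IsNilpotent N) : N.discr = 0 := by
  have ht := (isNilpotent_trace_of_isNilpotent hN).eq_zero
  have hd : N.det = 0 := by
    obtain ⟨n, hn⟩ := hN
    refine eq_zero_of_pow_eq_zero (n := n) ?_
    rw [← det_pow, hn, det_zero]
  simp [discr_fin_two, ht, hd]

variable [Finite F] (p : ℕ) [Fact p.Prime] [CharP F p]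

/-- An element of `GL₂` over a finite field is semisimple if and only if it is scalar or has
distinct eigenvalues. -/
theorem coprime_orderOf_iff_mem_range_scalar_or_discr_ne_zero (X : GL (Fin 2) F) :
    Nat.Coprime (orderOf X) p ↔ X.val ∈ Set.range (scalar (Fin 2)) ∨ X.val.discr ≠ 0 := by
  have hp : p.Prime := Fact.out
  constructor
  · intro h
    by_contra! hX
    obtain ⟨hns, hX⟩ := hX
    obtain ⟨a, ht, hd⟩ := exists_trace_det_sub_scalar_eq_zero hX
    have hN : (X.val - scalar (Fin 2) a) ^ p = 0 :=
      pow_eq_zero_of_le hp.two_le (sq_eq_zero_of_trace_of_det ht hd)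
    have hXp : X.val ^ p = scalar (Fin 2) (a ^ p) := by
      rw [sub_pow_char_of_commute _ (scalar_commute _ (Commute.all _) _).symm] at hN
      rw [sub_eq_zero.1 hN, map_pow]
    obtain ⟨m, hm⟩ := exists_pow_eq_self_of_coprime h.symm
    refine hns ⟨(a ^ p) ^ m, ?_⟩
    rw [map_pow, ← hXp, ← Units.val_pow_eq_pow_val, ← Units.val_pow_eq_pow_val, hm]
  · intro h
    rw [Nat.coprime_comm, hp.coprime_iff_not_dvd]
    intro hdvd
    set Z := X ^ (orderOf X / p) with hZ
    have hZo : orderOf Z = p := orderOf_pow_orderOf_div (orderOf_pos X).ne' hdvd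
    have hZ1 : (Z.val - 1) ^ p = 0 := by
      rw [sub_pow_char_of_commute _ (Commute.one_right _), one_pow, sub_eq_zero,
        ← Units.val_pow_eq_pow_val, ← hZo, pow_orderOf_eq_one, Units.val_one]
    have hdisc := discr_eq_zero_of_isNilpotent ⟨p, hZ1⟩
    have hcomm : Commute X.val Z.val := by
      rw [hZ, Units.val_pow_eq_pow_val]
      exact (Commute.refl _).pow_right _
    have hs : Z.val ∈ Set.range (scalar (Fin 2)) := by
      rcases h with ⟨a, ha⟩ | h
      · exact ⟨a ^ (orderOf X / p), by rw [map_pow, ha, hZ, Units.val_pow_eq_pow_val]⟩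
      · obtain ⟨u, v, huv⟩ := exists_eq_scalar_add_smul_of_commute
          (fun hs ↦ h (discr_eq_zero_of_mem_range_scalar hs)) hcomm
        have : Z.val - 1 = scalar (Fin 2) (u - 1) + v • X.val := by
          rw [huv, map_sub, map_one]
          abel
        rw [this, discr_scalar_add_smul] at hdisc
        have hv : v = 0 := by simpa [h] using hdisc
        exact ⟨u, by simp [huv, hv]⟩
    obtain ⟨a, ha⟩ := hs
    have ha1 : a = 1 := by
      rw [← ha, ← map_one (scalar (Fin 2)), ← map_sub, ← map_pow,
        ← map_zero (scalar (Fin 2)), scalar_inj] at hZ1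
      exact sub_eq_zero.1 (eq_zero_of_pow_eq_zero hZ1)
    have : Z = 1 := Units.ext (by rw [← ha, ha1, map_one, Units.val_one])
    rw [this, orderOf_one] at hZo
    exact hp.one_lt.ne hZo

end TwoByTwo

section Counting

variable {F : Type*} [Field F] [Fintype F] [DecidableEq F]

open Finset

theorem card_ne_zero_eq_card_sub_one :
    (#{a : F | a ≠ 0} : ℤ) = Fintype.card F - 1 := by
  have h := card_filter_add_card_filter_not (s := univ) (fun a : F ↦ a = 0)
  rw [filter_eq' univ (0 : F), if_pos (mem_univ _), card_singleton, card_univ] at h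
  rw [← h]
  push_cast
  ring

theorem card_matrix_fin_two_det_ne_zero :
    (#{X : Matrix (Fin 2) (Fin 2) F | X.det ≠ 0} : ℤ) =
      ((Fintype.card F : ℤ) ^ 2 - 1) * ((Fintype.card F : ℤ) ^ 2 - Fintype.card F) := by
  have h : #{X : Matrix (Fin 2) (Fin 2) F | X.det ≠ 0} = Nat.card (GL (Fin 2) F) := by
    rw [Nat.card_eq_fintype_card, ← card_univ]
    symm
    refine card_nbij Units.val ?_ Units.val_injective.injOn ?_
    · intro X _
      simpa using X.det_ne_zero
    · intro X hX
      exact ⟨GeneralLinearGroup.mkOfDetNeZero X (by simpa using hX), by simp, rfl⟩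
  have hq : 1 ≤ Fintype.card F := Fintype.card_pos
  rw [h, card_GL_field, Fin.prod_univ_two]
  simp only [Fin.val_zero, Fin.val_one, pow_zero, pow_one]
  rw [Nat.cast_mul, Nat.cast_sub (Nat.one_le_pow _ _ hq),
    Nat.cast_sub (Nat.le_self_pow two_ne_zero _)]
  push_cast
  rfl

/-- There are `q ^ 2` nilpotent `2 × 2` matrices over the field with `q` elements. -/
theorem card_matrix_fin_two_trace_det_eq_zero :
    #{N : Matrix (Fin 2) (Fin 2) F | N.trace = 0 ∧ N.det = 0} = Fintype.card F ^ 2 := by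
  have h₁ : #{N : Matrix (Fin 2) (Fin 2) F | (N.trace = 0 ∧ N.det = 0) ∧ N 0 1 = 0} =
      #(univ : Finset F) := by
    refine card_nbij' (fun N ↦ N 1 0) (fun c ↦ !![0, 0; c, 0]) ?_ ?_ ?_ ?_
    · intro N _
      simp
    · intro c _
      simp [trace_fin_two]
    · intro N hN
      simp only [trace_fin_two, det_fin_two, coe_filter, mem_univ, true_and,
        Set.mem_ofPred_eq] at hN
      ext i j
      fin_cases i <;> fin_cases j <;> simp <;> grind
    · intro c _
      simp
  have h₂ : #{N : Matrix (Fin 2) (Fin 2) F | (N.trace = 0 ∧ N.det = 0) ∧ ¬ N 0 1 = 0} =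
      #(({b : F | b ≠ 0} : Finset F) ×ˢ (univ : Finset F)) := by
    refine card_nbij' (fun N ↦ (N 0 1, N 0 0))
      (fun x ↦ !![x.2, x.1; -x.2 ^ 2 / x.1, -x.2]) ?_ ?_ ?_ ?_
    · intro N hN
      simp_all
    · rintro ⟨b, a⟩ h
      have hb : b ≠ 0 := by simpa using h
      simp [trace_fin_two, det_fin_two, hb]
      field_simp
      ring
    · intro N hN
      simp only [trace_fin_two, det_fin_two, coe_filter, mem_univ, true_and,
        Set.mem_ofPred_eq] at hN
      ext i j
      fin_cases i <;> fin_cases j <;> simp <;> grind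
    · rintro ⟨b, a⟩ _
      simp
  zify
  rw [← card_filter_add_card_filter_not (fun N : Matrix (Fin 2) (Fin 2) F ↦ N 0 1 = 0),
    filter_filter, filter_filter, h₁, h₂, card_product, Nat.cast_add, Nat.cast_mul,
    card_ne_zero_eq_card_sub_one, card_univ]
  ring

theorem card_matrix_fin_two_discr_eq_zero_det_ne_zero :
    (#{X : Matrix (Fin 2) (Fin 2) F | X.det ≠ 0 ∧ X.discr = 0} : ℤ) =
      (Fintype.card F - 1) * (Fintype.card F : ℤ) ^ 2 := by
  have h : #(({a : F | a ≠ 0} : Finset F) ×ˢ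
      ({N : Matrix (Fin 2) (Fin 2) F | N.trace = 0 ∧ N.det = 0} : Finset _)) =
      #{X : Matrix (Fin 2) (Fin 2) F | X.det ≠ 0 ∧ X.discr = 0} := by
    refine card_nbij (fun x ↦ x.2 + scalar (Fin 2) x.1) ?_ ?_ ?_
    · rintro ⟨a, N⟩ h
      simp only [trace_fin_two, det_fin_two, coe_product, coe_filter, mem_univ, true_and,
        Set.mem_prod, Set.mem_ofPred_eq] at h
      obtain ⟨ha, ht, hd⟩ := h
      have : (N + scalar (Fin 2) a).det = a ^ 2 := by
        simp [det_fin_two]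
        grind
      simp only [coe_filter, mem_univ, true_and, Set.mem_ofPred_eq, discr_fin_two, this]
      refine ⟨pow_ne_zero 2 ha, ?_⟩
      simp [trace_fin_two]
      grind
    · rintro ⟨a, N⟩ h ⟨a', N'⟩ h' heq
      simp only [trace_fin_two, det_fin_two, coe_product, coe_filter, mem_univ, true_and,
        Set.mem_prod, Set.mem_ofPred_eq] at h h'
      have h00 := congr_fun₂ heq 0 0
      have h01 := congr_fun₂ heq 0 1
      have h10 := congr_fun₂ heq 1 0
      have h11 := congr_fun₂ heq 1 1
      simp at h00 h01 h10 h11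
      have : (a - a') ^ 2 = 0 := by grind
      have ha : a = a' := sub_eq_zero.1 (pow_eq_zero_iff two_ne_zero |>.1 this)
      simpa [ha] using heq
    · intro X hX
      simp only [coe_filter, mem_univ, true_and, Set.mem_ofPred_eq] at hX
      obtain ⟨a, ht, hd⟩ := exists_trace_det_sub_scalar_eq_zero hX.2
      refine ⟨(a, X - scalar (Fin 2) a), ?_, sub_add_cancel _ _⟩
      simp only [coe_product, coe_filter, mem_univ, true_and, Set.mem_prod, Set.mem_ofPred_eq]
      refine ⟨?_, ht, hd⟩
      rintro rfl
      simp_all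
  rw [← h, card_product, card_matrix_fin_two_trace_det_eq_zero, Nat.cast_mul,
    card_ne_zero_eq_card_sub_one]
  push_cast
  rfl

/-- The number of regular semisimple elements of `GL₂`. -/
theorem card_matrix_fin_two_discr_ne_zero_det_ne_zero :
    (#{X : Matrix (Fin 2) (Fin 2) F | X.det ≠ 0 ∧ X.discr ≠ 0} : ℤ) =
      ((Fintype.card F : ℤ) ^ 2 - 1) * ((Fintype.card F : ℤ) ^ 2 - Fintype.card F) -
        (Fintype.card F - 1) * (Fintype.card F : ℤ) ^ 2 := by
  rw [← card_matrix_fin_two_discr_eq_zero_det_ne_zero, ← card_matrix_fin_two_det_ne_zero,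
    ← card_filter_add_card_filter_not (s := {X : Matrix (Fin 2) (Fin 2) F | X.det ≠ 0})
      (fun X : Matrix (Fin 2) (Fin 2) F ↦ X.discr = 0), filter_filter, filter_filter]
  push_cast
  ring

theorem card_matrix_fin_two_trace_ne_zero_det_eq_zero :
    (#{Z : Matrix (Fin 2) (Fin 2) F | Z.det = 0 ∧ Z.trace ≠ 0} : ℤ) =
      (Fintype.card F : ℤ) ^ 3 - Fintype.card F := by
  have h₁ := card_filter_add_card_filter_not (s := univ)
    (fun Z : Matrix (Fin 2) (Fin 2) F ↦ Z.det = 0)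
  have h₂ := card_filter_add_card_filter_not (s := {Z : Matrix (Fin 2) (Fin 2) F | Z.det = 0})
    (fun Z : Matrix (Fin 2) (Fin 2) F ↦ Z.trace = 0)
  rw [filter_filter, filter_filter] at h₂
  have h₃ := card_matrix_fin_two_trace_det_eq_zero (F := F)
  simp only [and_comm (b := Matrix.det (_ : Matrix (Fin 2) (Fin 2) F) = 0)] at h₃
  have h₄ := card_matrix_fin_two_det_ne_zero (F := F)
  rw [card_univ, ← Fintype.card_congr (of (m := Fin 2) (n := Fin 2) (α := F)), Fintype.card_fun,
    Fintype.card_fun, Fintype.card_fin, ← pow_mul] at h₁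
  zify at h₁ h₂ h₃
  linear_combination h₁ + h₂ - h₃ - h₄

/-- The number of regular semisimple elements of `GL₂`, together with an eigenvalue `-w`. -/
theorem card_matrix_fin_two_prod_det_add_scalar_eq_zero :
    (#{x : Matrix (Fin 2) (Fin 2) F × F | (x.1.det ≠ 0 ∧ x.1.discr ≠ 0) ∧
        (x.1 + scalar (Fin 2) x.2).det = 0} : ℤ) =
      ((Fintype.card F : ℤ) ^ 3 - Fintype.card F) * (Fintype.card F - 2) := by
  have h : #{x : Matrix (Fin 2) (Fin 2) F × F | (x.1.det ≠ 0 ∧ x.1.discr ≠ 0) ∧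
        (x.1 + scalar (Fin 2) x.2).det = 0} =
      #(({Z : Matrix (Fin 2) (Fin 2) F | Z.det = 0 ∧ Z.trace ≠ 0} : Finset _).sigma
        fun Z ↦ {0, Z.trace}ᶜ) := by
    refine card_nbij' (fun x ↦ ⟨x.1 + scalar (Fin 2) x.2, x.2⟩)
      (fun y ↦ (y.1 - scalar (Fin 2) y.2, y.2)) ?_ ?_ ?_ ?_
    · rintro ⟨X, w⟩ h
      simp [det_fin_two, trace_fin_two, discr_fin_two] at h ⊢
      grind
    · rintro ⟨Z, w⟩ h
      simp [det_fin_two, trace_fin_two, discr_fin_two] at h ⊢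
      grind
    · rintro ⟨X, w⟩ h
      simp
    · rintro ⟨Z, w⟩ h
      simp
  have h' (Z) (hZ : Z ∈ ({Z : Matrix (Fin 2) (Fin 2) F | Z.det = 0 ∧ Z.trace ≠ 0} : Finset _)) :
      (#({0, Z.trace}ᶜ : Finset F) : ℤ) = Fintype.card F - 2 := by
    have hZ : 0 ≠ Z.trace := (mem_filter.1 hZ).2.2.symm
    have := card_compl_add_card {0, Z.trace}
    rw [card_pair hZ] at this
    zify at this
    linear_combination this
  rw [h, card_sigma, Nat.cast_sum, sum_congr rfl h', sum_const, nsmul_eq_mul,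
    card_matrix_fin_two_trace_ne_zero_det_eq_zero]

theorem card_matrix_fin_two_prod_det_add_scalar_ne_zero :
    (#{x : Matrix (Fin 2) (Fin 2) F × F | (x.1.det ≠ 0 ∧ x.1.discr ≠ 0) ∧
        (x.1 + scalar (Fin 2) x.2).det ≠ 0} : ℤ) =
      Fintype.card F * #{X : Matrix (Fin 2) (Fin 2) F | X.det ≠ 0 ∧ X.discr ≠ 0} -
        ((Fintype.card F : ℤ) ^ 3 - Fintype.card F) * (Fintype.card F - 2) := by
  have h := card_filter_add_card_filter_not
    (s := ({X : Matrix (Fin 2) (Fin 2) F | X.det ≠ 0 ∧ X.discr ≠ 0} : Finset _) ×ˢ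
      (univ : Finset F)) (fun x ↦ (x.1 + scalar (Fin 2) x.2).det = 0)
  have h' : ({X : Matrix (Fin 2) (Fin 2) F | X.det ≠ 0 ∧ X.discr ≠ 0} : Finset _) ×ˢ
      (univ : Finset F) =
      ({x | x.1.det ≠ 0 ∧ x.1.discr ≠ 0} : Finset (Matrix (Fin 2) (Fin 2) F × F)) := by
    ext x
    simp
  rw [card_product, card_univ, h', filter_filter, filter_filter] at h
  have h₁ := card_matrix_fin_two_prod_det_add_scalar_eq_zero (F := F)
  zify at h
  linear_combination h - h₁

/-- The number of pairs of a regular semisimple `X` in `GL₂` and an element of its centralizer,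
given in the form `u + v X`. -/
theorem card_matrix_fin_two_prod_det_scalar_add_smul_ne_zero :
    (#{x : Matrix (Fin 2) (Fin 2) F × F × F | (x.1.det ≠ 0 ∧ x.1.discr ≠ 0) ∧
        (scalar (Fin 2) x.2.1 + x.2.2 • x.1).det ≠ 0} : ℤ) =
      (Fintype.card F - 1) * #{X : Matrix (Fin 2) (Fin 2) F | X.det ≠ 0 ∧ X.discr ≠ 0} +
      (Fintype.card F - 1) * (#{x : Matrix (Fin 2) (Fin 2) F × F |
        (x.1.det ≠ 0 ∧ x.1.discr ≠ 0) ∧ (x.1 + scalar (Fin 2) x.2).det ≠ 0} : ℤ) := by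
  have h₁ : #{x : Matrix (Fin 2) (Fin 2) F × F × F | ((x.1.det ≠ 0 ∧ x.1.discr ≠ 0) ∧
        (scalar (Fin 2) x.2.1 + x.2.2 • x.1).det ≠ 0) ∧ x.2.2 = 0} =
      #(({u : F | u ≠ 0} : Finset F) ×ˢ
        ({X : Matrix (Fin 2) (Fin 2) F | X.det ≠ 0 ∧ X.discr ≠ 0} : Finset _)) := by
    refine card_nbij' (fun x ↦ (x.2.1, x.1)) (fun y ↦ (y.2, y.1, 0)) ?_ ?_ ?_ ?_
    · rintro ⟨X, u, v⟩ h
      simp only [coe_product, coe_filter, mem_univ, true_and, Set.mem_prod,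
        Set.mem_ofPred_eq] at h ⊢
      obtain ⟨⟨hX, h⟩, rfl⟩ := h
      exact ⟨fun hu ↦ h (by simp [hu]), hX⟩
    · rintro ⟨u, X⟩ h
      simp only [coe_product, coe_filter, mem_univ, true_and, Set.mem_prod,
        Set.mem_ofPred_eq] at h ⊢
      exact ⟨⟨h.2, by simpa using h.1⟩, trivial⟩
    · rintro ⟨X, u, v⟩ h
      have hv : v = 0 := (mem_filter.1 h).2.2
      simp [hv]
    · rintro ⟨u, X⟩ h
      simp
  have h₂ : #{x : Matrix (Fin 2) (Fin 2) F × F × F | ((x.1.det ≠ 0 ∧ x.1.discr ≠ 0) ∧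
        (scalar (Fin 2) x.2.1 + x.2.2 • x.1).det ≠ 0) ∧ ¬ x.2.2 = 0} =
      #(({v : F | v ≠ 0} : Finset F) ×ˢ
        ({x : Matrix (Fin 2) (Fin 2) F × F | (x.1.det ≠ 0 ∧ x.1.discr ≠ 0) ∧
          (x.1 + scalar (Fin 2) x.2).det ≠ 0} : Finset _)) := by
    have key (X : Matrix (Fin 2) (Fin 2) F) (v w : F) :
        (scalar (Fin 2) (v * w) + v • X).det = v ^ 2 * (X + scalar (Fin 2) w).det := by
      simp [det_fin_two]
      ring
    refine card_nbij' (fun x ↦ (x.2.2, x.1, x.2.1 / x.2.2)) (fun y ↦ (y.2.1, y.1 * y.2.2, y.1))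
      ?_ ?_ ?_ ?_
    · rintro ⟨X, u, v⟩ h
      simp only [coe_product, coe_filter, mem_univ, true_and, Set.mem_prod,
        Set.mem_ofPred_eq] at h ⊢
      refine ⟨h.2, h.1.1, fun h0 ↦ h.1.2 ?_⟩
      rw [← mul_div_cancel₀ u h.2, key, h0, mul_zero]
    · rintro ⟨v, X, w⟩ h
      simp only [coe_product, coe_filter, mem_univ, true_and, Set.mem_prod,
        Set.mem_ofPred_eq] at h ⊢
      rw [key]
      exact ⟨⟨h.2.1, mul_ne_zero (pow_ne_zero 2 h.1) h.2.2⟩, h.1⟩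
    · rintro ⟨X, u, v⟩ h
      have hv : v ≠ 0 := (mem_filter.1 h).2.2
      simp [mul_div_cancel₀ _ hv]
    · rintro ⟨v, X, w⟩ h
      have hv : v ≠ 0 := by simp at h; exact h.1
      simp [hv]
  rw [← card_filter_add_card_filter_not
    (fun x : Matrix (Fin 2) (Fin 2) F × F × F ↦ x.2.2 = 0), filter_filter, filter_filter, h₁, h₂,
    card_product, card_product, Nat.cast_add, Nat.cast_mul, Nat.cast_mul,
    card_ne_zero_eq_card_sub_one]

theorem card_matrix_fin_two_det_ne_zero_mem_range_scalar :
    (#{X : Matrix (Fin 2) (Fin 2) F | X.det ≠ 0 ∧ X ∈ Set.range (scalar (Fin 2))} : ℤ) =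
      Fintype.card F - 1 := by
  rw [← card_ne_zero_eq_card_sub_one, Nat.cast_inj]
  symm
  refine card_nbij (scalar (Fin 2)) ?_ (fun a _ b _ ↦ scalar_inj.1) ?_
  · intro a h
    simpa using h
  · intro X hX
    simp only [coe_filter, mem_univ, true_and, Set.mem_ofPred_eq] at hX
    obtain ⟨hd, a, rfl⟩ := hX
    exact ⟨a, by simpa using hd, rfl⟩

/-- The number of semisimple elements of `GL₂`. -/
theorem card_matrix_fin_two_det_ne_zero_mem_range_scalar_or_discr_ne_zero :
    (#{X : Matrix (Fin 2) (Fin 2) F | X.det ≠ 0 ∧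
        (X ∈ Set.range (scalar (Fin 2)) ∨ X.discr ≠ 0)} : ℤ) =
      Fintype.card F - 1 + #{X : Matrix (Fin 2) (Fin 2) F | X.det ≠ 0 ∧ X.discr ≠ 0} := by
  rw [← card_matrix_fin_two_det_ne_zero_mem_range_scalar]
  simp only [and_or_left, filter_or]
  rw [card_union_of_disjoint, Nat.cast_add]
  rw [disjoint_filter]
  exact fun X _ h h' ↦ h'.2 (discr_eq_zero_of_mem_range_scalar h.2)

/-- Splitting the pairs of commuting semisimple elements of `GL₂` according to whether the first
one is scalar. -/
theorem card_commuting_semisimple_pairs_matrix_fin_two :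
    #{x : Matrix (Fin 2) (Fin 2) F × Matrix (Fin 2) (Fin 2) F | x.1 * x.2 = x.2 * x.1 ∧
        (x.1.det ≠ 0 ∧ (x.1 ∈ Set.range (scalar (Fin 2)) ∨ x.1.discr ≠ 0)) ∧
        (x.2.det ≠ 0 ∧ (x.2 ∈ Set.range (scalar (Fin 2)) ∨ x.2.discr ≠ 0))} =
      #{X : Matrix (Fin 2) (Fin 2) F | X.det ≠ 0 ∧ X ∈ Set.range (scalar (Fin 2))} *
        #{X : Matrix (Fin 2) (Fin 2) F | X.det ≠ 0 ∧
          (X ∈ Set.range (scalar (Fin 2)) ∨ X.discr ≠ 0)} +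
      #{x : Matrix (Fin 2) (Fin 2) F × F × F | (x.1.det ≠ 0 ∧ x.1.discr ≠ 0) ∧
        (scalar (Fin 2) x.2.1 + x.2.2 • x.1).det ≠ 0} := by
  rw [← card_filter_add_card_filter_not (fun x : Matrix (Fin 2) (Fin 2) F ×
    Matrix (Fin 2) (Fin 2) F ↦ x.1 ∈ Set.range (scalar (Fin 2))), filter_filter, filter_filter,
    ← card_product]
  congr 1
  · congr 1
    ext ⟨X, Y⟩
    simp only [mem_filter, mem_product, mem_univ, true_and]
    constructor
    · rintro ⟨⟨-, hX, hY⟩, hs⟩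
      exact ⟨⟨hX.1, hs⟩, hY⟩
    · rintro ⟨⟨hX, hs⟩, hY⟩
      refine ⟨⟨?_, ⟨hX, .inl hs⟩, hY⟩, hs⟩
      obtain ⟨a, rfl⟩ := hs
      exact (scalar_commute _ (Commute.all _) _).eq
  · symm
    refine card_nbij (fun x ↦ (x.1, scalar (Fin 2) x.2.1 + x.2.2 • x.1)) ?_ ?_ ?_
    · rintro ⟨X, u, v⟩ h
      simp only [coe_filter, mem_univ, true_and, Set.mem_ofPred_eq] at h ⊢
      obtain ⟨⟨hd, hX⟩, h⟩ := h
      refine ⟨⟨?_, ⟨hd, .inr hX⟩, h, ?_⟩, fun hs ↦ hX (discr_eq_zero_of_mem_range_scalar hs)⟩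
      · exact ((scalar_commute _ (Commute.all _) _).symm.add_right
          ((Commute.refl X).smul_right v)).eq
      · by_cases hv : v = 0
        · exact .inl ⟨u, by simp [hv]⟩
        · right
          rw [discr_scalar_add_smul]
          exact mul_ne_zero (pow_ne_zero 2 hv) hX
    · rintro ⟨X, u, v⟩ h ⟨X', u', v'⟩ - heq
      simp only [coe_filter, mem_univ, true_and, Set.mem_ofPred_eq] at h
      obtain ⟨rfl, heq⟩ := Prod.mk.inj heq
      have hs : X ∉ Set.range (scalar (Fin 2)) := fun hs ↦
        h.1.2 (discr_eq_zero_of_mem_range_scalar hs)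
      rw [mem_range_scalar_fin_two_iff] at hs
      have h00 := congr_fun₂ heq 0 0
      have h01 := congr_fun₂ heq 0 1
      have h10 := congr_fun₂ heq 1 0
      have h11 := congr_fun₂ heq 1 1
      simp at h00 h01 h10 h11
      have hv : v = v' := by grind
      simp only [hv, add_left_inj] at h00
      rw [h00, hv]
    · rintro ⟨X, Y⟩ h
      simp only [coe_filter, mem_univ, true_and, Set.mem_ofPred_eq] at h
      obtain ⟨⟨hc, ⟨hd, hX⟩, hY⟩, hs⟩ := h
      obtain ⟨u, v, rfl⟩ := exists_eq_scalar_add_smul_of_commute hs hc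
      refine ⟨(X, u, v), ?_, rfl⟩
      simp only [coe_filter, mem_univ, true_and, Set.mem_ofPred_eq]
      exact ⟨⟨hd, hX.resolve_left hs⟩, hY.1⟩

end Counting

end Matrix

/-- The number of ordered pairs of commuting semisimple (order prime to `p`) matrices in
`GL_2(F_q)` is `q^6 - 2q^5 - q^4 + 4q^3 - q^2 - 2q + 1`. -/
theorem card_commuting_semisimple_pairs_GL2
    (p : ℕ) (hp : p.Prime) (F : Type*) [Field F] [Fintype F] [CharP F p]
    (q : ℤ) (hq : (Fintype.card F : ℤ) = q) :
    (Nat.card {XY : GL (Fin 2) F × GL (Fin 2) F //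
        Commute XY.1 XY.2 ∧ Nat.Coprime (orderOf XY.1) p ∧ Nat.Coprime (orderOf XY.2) p} : ℤ) =
      q ^ 6 - 2 * q ^ 5 - q ^ 4 + 4 * q ^ 3 - q ^ 2 - 2 * q + 1 := by
  classical
  have : Fact p.Prime := ⟨hp⟩
  rw [Nat.card_eq_fintype_card, Fintype.card_subtype]
  simp only [Matrix.coprime_orderOf_iff_mem_range_scalar_or_discr_ne_zero]
  refine (congrArg Nat.cast ((Finset.card_nbij (fun XY ↦ (XY.1.val, XY.2.val)) ?_ ?_ ?_).trans
    Matrix.card_commuting_semisimple_pairs_matrix_fin_two)).trans ?_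
  · rintro ⟨X, Y⟩ h
    simp only [Finset.coe_filter, Finset.mem_univ, true_and, Set.mem_ofPred_eq] at h ⊢
    exact ⟨(h.1.map (Units.coeHom _)).eq, ⟨X.det_ne_zero, h.2.1⟩, Y.det_ne_zero, h.2.2⟩
  · exact (Units.val_injective.prodMap Units.val_injective).injOn
  · rintro ⟨X, Y⟩ h
    simp only [Finset.coe_filter, Finset.mem_univ, true_and, Set.mem_ofPred_eq] at h
    obtain ⟨hc, hX, hY⟩ := h
    refine ⟨(Matrix.GeneralLinearGroup.mkOfDetNeZero X hX.1,
      Matrix.GeneralLinearGroup.mkOfDetNeZero Y hY.1), ?_, rfl⟩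
    simp only [Finset.coe_filter, Finset.mem_univ, true_and, Set.mem_ofPred_eq]
    exact ⟨Units.ext hc, hX.2, hY.2⟩
  · rw [Nat.cast_add, Nat.cast_mul, Matrix.card_matrix_fin_two_det_ne_zero_mem_range_scalar,
      Matrix.card_matrix_fin_two_det_ne_zero_mem_range_scalar_or_discr_ne_zero,
      Matrix.card_matrix_fin_two_prod_det_scalar_add_smul_ne_zero,
      Matrix.card_matrix_fin_two_prod_det_add_scalar_ne_zero,
      Matrix.card_matrix_fin_two_discr_ne_zero_det_ne_zero, hq]
    ring
end

section
/- The number of ordered pairs of commuting semisimple matrices in GL_3(F_q) equals |GL_3(F_q)| * (q^6 - q^5 - q^4 + 2q^3 - q^2 + q - 1)/q^3, i.e., q^12 - 2q^11 - q^10 + 4q^9 - q^8 - 4q^6 + 2q^5 + 3q^4 - 2q^3 + q^2 - 2q + 1. -/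
section

open Polynomial Matrix

theorem card_mul_card_of_action {G α : Type*} [Group G]
    (act : G → α → α) (act_one : ∀ x, act 1 x = x)
    (act_mul : ∀ g h x, act (g * h) x = act g (act h x)) (H : Subgroup G) (S T : Set α)
    (hS : ∀ h ∈ H, ∀ s ∈ S, act h s ∈ S) (hH : ∀ g, ∀ s ∈ S, act g s ∈ S → g ∈ H)
    (hT : ∀ t, t ∈ T ↔ ∃ g, ∃ s ∈ S, act g s = t) :
    Nat.card T * Nat.card H = Nat.card G * Nat.card S := by
  choose g s hs hgs using fun t : T => (hT t).1 t.2
  have inv_act (h : G) (x : α) : act h⁻¹ (act h x) = x := by rw [← act_mul, inv_mul_cancel, act_one]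
  have act_inv (h : G) (x : α) : act h (act h⁻¹ x) = x := by rw [← act_mul, mul_inv_cancel, act_one]
  let f : T × H → G × S := fun x =>
    (g x.1 * x.2, ⟨act (x.2 : G)⁻¹ (s x.1), hS _ (H.inv_mem x.2.2) _ (hs x.1)⟩)
  have hf (x : T × H) : act (f x).1 (f x).2 = x.1 := by simp only [f, act_mul, act_inv, hgs]
  rw [← Nat.card_prod, ← Nat.card_prod]
  refine Nat.card_eq_of_bijective f ⟨fun x y hxy => ?_, fun ⟨g₀, s₀⟩ => ?_⟩
  · have h1 : x.1 = y.1 := Subtype.ext (by rw [← hf x, ← hf y, hxy])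
    have h2 : g x.1 * x.2 = g y.1 * y.2 := congrArg Prod.fst hxy
    rw [h1] at h2
    exact Prod.ext h1 (Subtype.ext (mul_left_cancel h2))
  · let t : T := ⟨act g₀ s₀, (hT _).2 ⟨g₀, s₀, s₀.2, rfl⟩⟩
    have ht : act (g t) (s t) = act g₀ s₀ := hgs t
    have hst : act ((g t)⁻¹ * g₀) s₀ = s t := by rw [act_mul, ← ht, inv_act]
    refine ⟨(t, ⟨(g t)⁻¹ * g₀, hH _ _ s₀.2 (hst ▸ hs t)⟩), Prod.ext ?_ (Subtype.ext ?_)⟩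
    · simp [f]
    · simp only [f]
      rw [← hst, inv_act]

theorem Nat.card_subtype_eq_add {α : Type*} [Finite α] (P Q : α → Prop) :
    Nat.card {x // P x} = Nat.card {x // P x ∧ Q x} + Nat.card {x // P x ∧ ¬ Q x} := by
  classical
  have := Fintype.ofFinite α
  simp only [Nat.card_eq_fintype_card, Fintype.card_subtype, ← Finset.filter_filter]
  exact (Finset.card_filter_add_card_filter_not _).symm

theorem Nat.card_subtype_exists_eq_sum {α β ι : Type*} [Finite α] [Fintype ι]
    (P : α → Prop) (f : α → β)
    (d : ι → β) (hd : Function.Injective d) :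
    Nat.card {x // P x ∧ ∃ i, f x = d i} = ∑ i, Nat.card {x // P x ∧ f x = d i} := by
  rw [← Nat.card_sigma]
  symm
  refine Nat.card_eq_of_bijective
    (fun x : (i : ι) × {x // P x ∧ f x = d i} => ⟨x.2.1, x.2.2.1, x.1, x.2.2.2⟩) ⟨?_, ?_⟩
  · rintro ⟨i, x, hx⟩ ⟨j, y, hy⟩ h
    obtain rfl : x = y := congrArg Subtype.val h
    obtain rfl : i = j := hd (hx.2.symm.trans hy.2)
    rfl
  · rintro ⟨x, hx, i, hi⟩
    exact ⟨⟨i, x, hx, hi⟩, rfl⟩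

variable {F : Type*} [Field F]

/-- The cubic `(X - a)² (X - b)`. -/
noncomputable def doubleRootCubic (a b : F) : F[X] := (X - C a) ^ 2 * (X - C b)

theorem doubleRootCubic_monic (a b : F) : (doubleRootCubic a b).Monic :=
  ((monic_X_sub_C a).pow 2).mul (monic_X_sub_C b)

theorem doubleRootCubic_injective {a b a' b' : F}
    (h : doubleRootCubic a b = doubleRootCubic a' b') : a = a' ∧ b = b' := by
  have h1 := congrArg roots h
  have key (a b : F) : (doubleRootCubic a b).roots = {a, a, b} := by
    rw [doubleRootCubic, roots_mul (doubleRootCubic_monic a b).ne_zero, roots_pow]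
    simp [two_nsmul]
  rw [key, key] at h1
  classical
  have ha := congrArg (Multiset.count a) h1
  have hb := congrArg (Multiset.count b) h1
  simp [Multiset.count_cons, Multiset.count_singleton] at ha hb
  grind

theorem not_squarefree_doubleRootCubic (a b : F) : ¬ Squarefree (doubleRootCubic a b) := fun h =>
  not_isUnit_X_sub_C a (h _ ⟨X - C b, by rw [doubleRootCubic]; ring⟩)

theorem exists_sq_mul_eq_of_not_squarefree {f : F[X]} (hf : f.Monic) (hdeg : f.natDegree ≤ 3)
    (hsq : ¬ Squarefree f) : ∃ a g, g.Monic ∧ f = (X - C a) ^ 2 * g := by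
  rw [squarefree_iff_no_irreducibles hf.ne_zero] at hsq
  push Not at hsq
  obtain ⟨d, hd, hdf⟩ := hsq
  have hd1 : d.natDegree = 1 := by
    have h1 := hd.natDegree_pos
    have h2 := natDegree_le_of_dvd hdf hf.ne_zero
    rw [natDegree_mul hd.ne_zero hd.ne_zero] at h2
    omega
  obtain ⟨a, ha⟩ := exists_root_of_degree_eq_one
    (show d.degree = 1 by rw [degree_eq_natDegree hd.ne_zero, hd1]; rfl)
  have h3 : (X - C a) ^ 2 ∣ f := by
    rw [pow_two]
    exact (mul_dvd_mul (dvd_iff_isRoot.2 ha) (dvd_iff_isRoot.2 ha)).trans hdf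
  obtain ⟨g, hg⟩ := h3
  exact ⟨a, g, ((monic_X_sub_C a).pow 2).of_mul_monic_left (hg ▸ hf), hg⟩

theorem natDegree_X_sub_C_sq_mul (a : F) {g : F[X]} (hg : g.Monic) :
    ((X - C a) ^ 2 * g).natDegree = 2 + g.natDegree := by
  rw [((monic_X_sub_C a).pow 2).natDegree_mul hg, natDegree_pow, natDegree_X_sub_C, mul_one]

theorem exists_eq_X_sub_C {g : F[X]} (hg : g.Monic) (h : g.natDegree = 1) : ∃ b, g = X - C b :=
  ⟨-g.coeff 0, by rw [C_neg, sub_neg_eq_add]; exact hg.eq_X_add_C h⟩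

theorem exists_eq_doubleRootCubic {f : F[X]} (hf : f.Monic) (hdeg : f.natDegree = 3)
    (hsq : ¬ Squarefree f) : ∃ a b, f = doubleRootCubic a b := by
  obtain ⟨a, g, hg, rfl⟩ := exists_sq_mul_eq_of_not_squarefree hf hdeg.le hsq
  rw [natDegree_X_sub_C_sq_mul a hg] at hdeg
  obtain ⟨b, rfl⟩ := exists_eq_X_sub_C hg (by omega)
  exact ⟨a, b, rfl⟩

theorem exists_eq_X_sub_C_sq {f : F[X]} (hf : f.Monic) (hdeg : f.natDegree = 2)
    (hsq : ¬ Squarefree f) : ∃ a, f = (X - C a) ^ 2 := by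
  obtain ⟨a, g, hg, rfl⟩ := exists_sq_mul_eq_of_not_squarefree hf (by omega) hsq
  rw [natDegree_X_sub_C_sq_mul a hg] at hdeg
  rw [hg.natDegree_eq_zero.1 (by omega), mul_one]
  exact ⟨a, rfl⟩

/-- The monic cubic with lower coefficients `c`. -/
noncomputable def monicCubic (c : F × F × F) : F[X] :=
  X ^ 3 + C c.2.2 * X ^ 2 + C c.2.1 * X + C c.1

theorem monicCubic_monic (c : F × F × F) : (monicCubic c).Monic := by
  rw [monicCubic]
  monicity!

theorem natDegree_monicCubic (c : F × F × F) : (monicCubic c).natDegree = 3 := by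
  rw [monicCubic]
  compute_degree!

theorem monicCubic_coeff {f : F[X]} (hf : f.Monic) (hdeg : f.natDegree = 3) :
    monicCubic (f.coeff 0, f.coeff 1, f.coeff 2) = f := by
  have h3 : f.coeff 3 = 1 := by rw [← hdeg]; exact hf
  conv_rhs => rw [f.as_sum_range, hdeg]
  simp [Finset.sum_range_succ, monicCubic, ← C_mul_X_pow_eq_monomial, h3]
  ring

theorem coeff_monicCubic (c : F × F × F) :
    ((monicCubic c).coeff 0, (monicCubic c).coeff 1, (monicCubic c).coeff 2) = c := by
  simp [monicCubic, coeff_X, coeff_C]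

theorem monicCubic_injective : Function.Injective (monicCubic (F := F)) := fun c d h => by
  rw [← coeff_monicCubic c, h, coeff_monicCubic]

theorem natDegree_doubleRootCubic (a b : F) : (doubleRootCubic a b).natDegree = 3 := by
  rw [doubleRootCubic, natDegree_mul (pow_ne_zero _ (X_sub_C_ne_zero a)) (X_sub_C_ne_zero b),
    natDegree_pow, natDegree_X_sub_C, natDegree_X_sub_C]

theorem eval_zero_doubleRootCubic (a b : F) : (doubleRootCubic a b).eval 0 = - a ^ 2 * b := by
  simp [doubleRootCubic]

theorem not_squarefree_iff_exists_eq_doubleRootCubic {f : F[X]} (hf : f.Monic)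
    (hdeg : f.natDegree = 3) (h0 : f.eval 0 ≠ 0) :
    ¬ Squarefree f ↔ ∃ ab : Fˣ × Fˣ, f = doubleRootCubic (ab.1 : F) ab.2 := by
  constructor
  · intro h
    obtain ⟨a, b, rfl⟩ := exists_eq_doubleRootCubic hf hdeg h
    rw [eval_zero_doubleRootCubic] at h0
    exact ⟨(Units.mk0 a (by rintro rfl; simp at h0), Units.mk0 b (by rintro rfl; simp at h0)), rfl⟩
  · rintro ⟨ab, rfl⟩
    exact not_squarefree_doubleRootCubic _ _

theorem doubleRootCubic_units_injective :
    Function.Injective fun ab : Fˣ × Fˣ => doubleRootCubic (ab.1 : F) ab.2 := fun x y h => by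
  have := doubleRootCubic_injective h
  exact Prod.ext (Units.ext this.1) (Units.ext this.2)

theorem card_squarefree_monicCubic [Finite F] :
    Nat.card {c : F × F × F // (monicCubic c).eval 0 ≠ 0 ∧ Squarefree (monicCubic c)}
      + Nat.card Fˣ ^ 2 = Nat.card Fˣ * Nat.card F ^ 2 := by
  classical
  have := Fintype.ofFinite F
  have htot : Nat.card {c : F × F × F // (monicCubic c).eval 0 ≠ 0} =
      Nat.card Fˣ * Nat.card F ^ 2 := by
    rw [pow_two, ← Nat.card_prod, ← Nat.card_prod]
    refine Nat.card_congr ⟨fun c => (Units.mk0 c.1.1 (by simpa [monicCubic] using c.2), c.1.2),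
      fun c => ⟨(c.1, c.2), by simp [monicCubic]⟩, fun c => rfl, fun c => ?_⟩
    ext <;> rfl
  rw [← htot, Nat.card_subtype_eq_add (fun c : F × F × F => (monicCubic c).eval 0 ≠ 0)
    fun c => Squarefree (monicCubic c)]
  congr 1
  have h1 : Nat.card {c : F × F × F // (monicCubic c).eval 0 ≠ 0 ∧ ¬ Squarefree (monicCubic c)} =
      Nat.card {c : F × F × F // (monicCubic c).eval 0 ≠ 0 ∧
        ∃ ab : Fˣ × Fˣ, monicCubic c = doubleRootCubic (ab.1 : F) ab.2} :=
    Nat.card_congr <| Equiv.subtypeEquivRight fun c => and_congr_right fun h =>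
      not_squarefree_iff_exists_eq_doubleRootCubic (monicCubic_monic c) (natDegree_monicCubic c) h
  rw [h1, Nat.card_subtype_exists_eq_sum _ _ _ doubleRootCubic_units_injective]
  rw [Finset.sum_congr rfl (g := fun _ => 1)]
  · simp [pow_two, Nat.card_eq_fintype_card]
  · intro ab _
    rw [Nat.card_eq_one_iff_unique]
    refine ⟨⟨fun x y => Subtype.ext (monicCubic_injective (x.2.2.trans y.2.2.symm))⟩, ?_⟩
    have h := monicCubic_coeff (doubleRootCubic_monic (ab.1 : F) ab.2)
      (natDegree_doubleRootCubic (ab.1 : F) ab.2)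
    refine ⟨⟨_, ?_, h⟩⟩
    rw [h, eval_zero_doubleRootCubic]
    simp

/-! ### Semisimplicity -/

section Semisimple

variable {n : Type*} [Fintype n] [DecidableEq n] {p : ℕ}

theorem pow_eq_zero_of_squarefree_minpoly {X : Matrix n n F} (h : Squarefree (minpoly F X))
    (f : F[X]) {k : ℕ} (hk : aeval X f ^ k = 0) : aeval X f = 0 := by
  rw [← map_pow, ← minpoly.dvd_iff] at hk
  rw [← minpoly.dvd_iff]
  rcases eq_or_ne k 0 with rfl | h0
  · exact (isUnit_of_dvd_one (by simpa using hk)).dvd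
  · exact (h.dvd_pow_iff_dvd h0).1 hk

theorem coprime_orderOf_of_reduced [Finite F] (hp : p.Prime) [CharP F p] {X : GL n F}
    (h : ∀ k : ℕ, ((X : Matrix n n F) ^ k - 1) ^ p = 0 → (X : Matrix n n F) ^ k - 1 = 0) :
    (orderOf X).Coprime p := by
  have := Fact.mk hp
  rw [Nat.coprime_comm, hp.coprime_iff_not_dvd]
  rintro ⟨k, hk⟩
  have h0 : 0 < orderOf X := orderOf_pos X
  have h1 : (X : Matrix n n F) ^ k - 1 = 0 := by
    rcases isEmpty_or_nonempty n with hn | hn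
    · exact Subsingleton.elim _ _
    refine h k ?_
    have : CharP (Matrix n n F) p := inferInstance
    rw [sub_pow_char_of_commute _ (Commute.one_right _), ← pow_mul, mul_comm, ← hk, one_pow,
      ← Units.val_pow_eq_pow_val, pow_orderOf_eq_one, Units.val_one, sub_self]
  have h2 : X ^ k = 1 := Units.ext (by simpa [sub_eq_zero] using h1)
  have h3 := orderOf_le_of_pow_eq_one (Nat.pos_of_mul_pos_left (by rw [← hk]; exact h0)) h2
  have h4 := hp.two_le
  have h5 : 0 < k := Nat.pos_of_ne_zero (by rintro rfl; simp at hk; omega)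
  nlinarith

theorem coprime_orderOf_iff_squarefree_minpoly [Finite F] (hp : p.Prime) [CharP F p] (X : GL n F) :
    (orderOf X).Coprime p ↔ Squarefree (minpoly F (X : Matrix n n F)) := by
  constructor
  · intro h
    have h0 : ((orderOf X : ℕ) : F) ≠ 0 := by
      rwa [Ne, CharP.cast_eq_zero_iff F p, ← hp.coprime_iff_not_dvd, Nat.coprime_comm]
    refine ((separable_X_pow_sub_C 1 h0 one_ne_zero).squarefree).squarefree_of_dvd ?_
    refine minpoly.dvd _ _ ?_
    rw [map_sub, map_pow, aeval_X, map_one, map_one, ← Units.val_pow_eq_pow_val,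
      pow_orderOf_eq_one, Units.val_one, sub_self]
  · intro h
    refine coprime_orderOf_of_reduced hp fun k hk => ?_
    have : (X : Matrix n n F) ^ k - 1 = aeval (X : Matrix n n F) (Polynomial.X ^ k - 1 : F[X]) := by
      simp
    rw [this] at hk ⊢
    exact pow_eq_zero_of_squarefree_minpoly h _ hk

theorem squarefree_minpoly_of_squarefree_charpoly {X : Matrix n n F} (h : Squarefree X.charpoly) :
    Squarefree (minpoly F X) :=
  h.squarefree_of_dvd (Matrix.minpoly_dvd_charpoly X)

end Semisimple

/-! ### Cyclic matrices -/

section Cyclic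

theorem minpoly_eq_charpoly_of_squarefree {n : Type*} [Fintype n] [DecidableEq n]
    {X : Matrix n n F} (h : Squarefree X.charpoly) : minpoly F X = X.charpoly := by
  obtain ⟨g, hg⟩ := Matrix.minpoly_dvd_charpoly X
  have hmonic : g.Monic :=
    (minpoly.monic (Algebra.IsIntegral.isIntegral X)).of_mul_monic_left (hg ▸ X.charpoly_monic)
  suffices g = 1 by rw [hg, this, mul_one]
  refine hmonic.natDegree_eq_zero.1 ?_
  by_contra hdeg
  let K := AlgebraicClosure F
  let ι := algebraMap F K
  obtain ⟨r, hr⟩ := IsAlgClosed.exists_root (g.map ι) (by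
    rw [degree_map, degree_eq_natDegree hmonic.ne_zero]; exact_mod_cast hdeg)
  have hr2 : ((X.map ι).charpoly).IsRoot r := by
    rw [Matrix.charpoly_map, hg, Polynomial.map_mul]
    exact root_mul_left_of_isRoot _ hr
  have hr3 : ((minpoly F X).map ι).IsRoot r := by
    have h1 := Matrix.mem_spectrum_of_isRoot_charpoly hr2
    have h2 := spectrum.subset_polynomial_aeval (X.map ι) ((minpoly F X).map ι) ⟨r, h1, rfl⟩
    have h3 : aeval (X.map ι) ((minpoly F X).map ι) = 0 := by
      rw [aeval_map_algebraMap]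
      have := aeval_algHom_apply ((Algebra.ofId F K).mapMatrix (m := n)) X (minpoly F X)
      rw [minpoly.aeval, map_zero] at this
      exact this
    rw [h3] at h2
    have : Nontrivial (Matrix n n K) := by
      by_contra hn
      rw [not_nontrivial_iff_subsingleton] at hn
      simp [spectrum.of_subsingleton] at h2
    simpa [spectrum.zero_eq] using h2
  rw [hg] at h
  have hc : IsCoprime (minpoly F X) g := (squarefree_mul_iff.1 h).1.isCoprime
  obtain ⟨u, v, huv⟩ := hc.map (Polynomial.mapRingHom ι)
  have := congrArg (eval r) huv
  simp only [coe_mapRingHom, eval_add, eval_mul, hr.eq_zero, hr3.eq_zero] at this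
  simp at this

/-- The companion matrix of `monicCubic c`. -/
def companionCubic (c : F × F × F) : Matrix (Fin 3) (Fin 3) F :=
  !![0, 0, -c.1; 1, 0, -c.2.1; 0, 1, -c.2.2]

theorem charpoly_companionCubic (c : F × F × F) : (companionCubic c).charpoly = monicCubic c := by
  simp [companionCubic, Matrix.charpoly, Matrix.charmatrix, Matrix.det_fin_three, monicCubic]
  ring

/-- The matrix with columns `v`, `X v`, `X² v`. -/
def krylov (X : Matrix (Fin 3) (Fin 3) F) (v : Fin 3 → F) : Matrix (Fin 3) (Fin 3) F :=
  Matrix.of fun i j => (X ^ (j : ℕ) *ᵥ v) i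

theorem krylov_mulVec (X : Matrix (Fin 3) (Fin 3) F) (v u : Fin 3 → F) :
    krylov X v *ᵥ u =
      aeval X (C (u 0) + C (u 1) * Polynomial.X + C (u 2) * Polynomial.X ^ 2) *ᵥ v := by
  ext i
  simp [krylov, Matrix.mulVec_eq_sum, Fin.sum_univ_three, Algebra.algebraMap_eq_smul_one]
  ring

theorem krylov_mul_companionCubic {X : Matrix (Fin 3) (Fin 3) F} {c : F × F × F}
    (h : X.charpoly = monicCubic c) (v : Fin 3 → F) :
    krylov X v * companionCubic c = X * krylov X v := by
  have hX := Matrix.aeval_self_charpoly X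
  rw [h, monicCubic] at hX
  have h3 : X ^ 3 *ᵥ v = - (c.2.2 • (X ^ 2 *ᵥ v)) - c.2.1 • (X *ᵥ v) - c.1 • v := by
    have := congrArg (· *ᵥ v) hX
    simp [Matrix.add_mulVec, Algebra.algebraMap_eq_smul_one, Matrix.smul_mulVec] at this
    rw [← sub_eq_zero, ← this]
    abel
  have hcol (j : Fin 3) : (X * krylov X v).col j = X ^ (j + 1 : ℕ) *ᵥ v := by
    rw [pow_succ', ← Matrix.mulVec_mulVec]
    rfl
  ext i j
  have := congrFun (hcol j) i
  rw [Matrix.col_apply] at this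
  rw [this]
  fin_cases j
  · simp [Matrix.mul_apply, Fin.sum_univ_three, krylov, companionCubic]
  · simp [Matrix.mul_apply, Fin.sum_univ_three, krylov, companionCubic]
  · simp [Matrix.mul_apply, Fin.sum_univ_three, krylov, companionCubic, h3]
    ring

theorem exists_isUnit_krylov {X : Matrix (Fin 3) (Fin 3) F} (h : Squarefree X.charpoly) :
    ∃ v, IsUnit (krylov X v) := by
  obtain ⟨w, hw⟩ := Module.exists_ker_toSpanSingleton_eq_annihilator F[X]
    (M := Module.AEval' (Matrix.toLin' X))
  obtain ⟨v, rfl⟩ := (Module.AEval'.of (Matrix.toLin' X)).surjective w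
  refine ⟨v, ?_⟩
  rw [Matrix.isUnit_iff_isUnit_det, isUnit_iff_ne_zero]
  intro hdet
  obtain ⟨u, hu, hu0⟩ := Matrix.exists_mulVec_eq_zero_iff.2 hdet
  rw [krylov_mulVec] at hu0
  set f : F[X] := C (u 0) + C (u 1) * Polynomial.X + C (u 2) * Polynomial.X ^ 2 with hf
  have h1 : f ∈ LinearMap.ker
      (LinearMap.toSpanSingleton F[X] _ (Module.AEval'.of (Matrix.toLin' X) v)) := by
    rw [LinearMap.mem_ker, LinearMap.toSpanSingleton_apply, ← Module.AEval.of_aeval_smul]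
    have h2 := aeval_algHom_apply (Matrix.toLinAlgEquiv' (R := F) (n := Fin 3)).toAlgHom X f
    have h3 : aeval (Matrix.toLin' X) f = Matrix.toLin' (aeval X f) := h2
    rw [h3, Module.End.smul_def, Matrix.toLin'_apply, hu0, map_zero]
  rw [hw] at h1
  have h2 : minpoly F X ∣ f := by
    rw [← Matrix.minpoly_toLin', minpoly.dvd_iff]
    have := Module.AEval.annihilator_eq_ker_aeval (R := F) (M := Fin 3 → F) (Matrix.toLin' X)
    rw [← RingHom.mem_ker, ← this]
    exact h1
  have hdeg : f.natDegree ≤ 2 := by rw [hf]; compute_degree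
  have hf0 : f = 0 := by
    by_contra hne
    have := natDegree_le_of_dvd h2 hne
    rw [minpoly_eq_charpoly_of_squarefree h, Matrix.charpoly_natDegree_eq_dim] at this
    simp at this
    omega
  apply hu
  ext i
  have hi := congrArg (fun g => g.coeff i) hf0
  fin_cases i <;> simpa [hf, coeff_X, coeff_C] using hi

theorem exists_conj_companionCubic (X : Matrix (Fin 3) (Fin 3) F) (h : Squarefree X.charpoly) :
    ∃ P : GL (Fin 3) F, ∀ c, X.charpoly = monicCubic c →
      (P : Matrix (Fin 3) (Fin 3) F) * companionCubic c = X * P := by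
  obtain ⟨v, hv⟩ := exists_isUnit_krylov h
  exact ⟨hv.unit, fun c hc => krylov_mul_companionCubic hc v⟩

end Cyclic

section Regular

theorem exists_eq_aeval_of_commute {X N : Matrix (Fin 3) (Fin 3) F} (h : Squarefree X.charpoly)
    (hN : Commute X N) : ∃ r : F[X], N = aeval X r := by
  obtain ⟨v, hv⟩ := exists_isUnit_krylov h
  obtain ⟨u, hu⟩ := (Matrix.mulVec_surjective_iff_isUnit.2 hv) (N *ᵥ v)
  rw [krylov_mulVec] at hu
  set f : F[X] := C (u 0) + C (u 1) * Polynomial.X + C (u 2) * Polynomial.X ^ 2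
  refine ⟨f, hv.mul_right_cancel ?_⟩
  have hcol (M : Matrix (Fin 3) (Fin 3) F) (hM : Commute X M) (j : Fin 3) :
      (M * krylov X v).col j = X ^ (j : ℕ) *ᵥ (M *ᵥ v) := by
    rw [Matrix.mulVec_mulVec, (hM.pow_left j).eq, ← Matrix.mulVec_mulVec]
    rfl
  ext i j
  have h1 := congrFun (hcol N hN j) i
  have h2 := congrFun (hcol _
    (Algebra.commute_of_mem_adjoin_self (aeval_mem_adjoin_singleton F X (p := f))) j) i
  rw [Matrix.col_apply] at h1 h2
  rw [h1, h2, hu]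

theorem coprime_orderOf_of_commute [Finite F] {p : ℕ} (hp : p.Prime) [CharP F p]
    {X Y : GL (Fin 3) F} (h : Squarefree (X : Matrix (Fin 3) (Fin 3) F).charpoly)
    (hXY : Commute X Y) : (orderOf Y).Coprime p := by
  refine coprime_orderOf_of_reduced hp fun k hk => ?_
  have hc : Commute (X : Matrix (Fin 3) (Fin 3) F) Y := hXY.map (Units.coeHom _)
  obtain ⟨r, hr⟩ := exists_eq_aeval_of_commute h
    ((hc.pow_right k).sub_right (Commute.one_right _))
  rw [hr] at hk ⊢
  exact pow_eq_zero_of_squarefree_minpoly (squarefree_minpoly_of_squarefree_charpoly h) r hk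

theorem eval_zero_charpoly_ne_zero_iff {n : Type*} [Fintype n] [DecidableEq n]
    (X : Matrix n n F) : X.charpoly.eval 0 ≠ 0 ↔ IsUnit X := by
  rw [Matrix.isUnit_iff_isUnit_det, isUnit_iff_ne_zero, Matrix.det_eq_sign_charpoly_coeff,
    coeff_zero_eq_eval_zero]
  simp

theorem charpoly_units_mul_mul_inv {n : Type*} [Fintype n] [DecidableEq n] (P : GL n F)
    (M : Matrix n n F) :
    ((P : Matrix n n F) * M * (P⁻¹ : GL n F)).charpoly = M.charpoly := by
  rw [Matrix.charpoly_mul_comm, ← mul_assoc, Units.inv_mul, one_mul]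

theorem charpoly_conj {n : Type*} [Fintype n] [DecidableEq n] (P X : GL n F) :
    ((P * X * P⁻¹ : GL n F) : Matrix n n F).charpoly = (X : Matrix n n F).charpoly :=
  charpoly_units_mul_mul_inv P X

theorem card_commuting_of_squarefree_charpoly [Finite F] :
    Nat.card {XY : GL (Fin 3) F × GL (Fin 3) F //
        Commute XY.1 XY.2 ∧ Squarefree (XY.1 : Matrix (Fin 3) (Fin 3) F).charpoly} =
      Nat.card (GL (Fin 3) F) *
        Nat.card {c : F × F × F // (monicCubic c).eval 0 ≠ 0 ∧ Squarefree (monicCubic c)} := by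
  let coeffs (X : GL (Fin 3) F) : F × F × F :=
    ((X : Matrix (Fin 3) (Fin 3) F).charpoly.coeff 0,
      (X : Matrix (Fin 3) (Fin 3) F).charpoly.coeff 1,
      (X : Matrix (Fin 3) (Fin 3) F).charpoly.coeff 2)
  have hcoeffs (X : GL (Fin 3) F) :
      (X : Matrix (Fin 3) (Fin 3) F).charpoly = monicCubic (coeffs X) :=
    (monicCubic_coeff (Matrix.charpoly_monic _) (by simp)).symm
  choose! P hP using fun X : GL (Fin 3) F => exists_conj_companionCubic (F := F) X
  have hPX (X : GL (Fin 3) F) (h : Squarefree (X : Matrix (Fin 3) (Fin 3) F).charpoly) :=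
    hP X h _ (hcoeffs X)
  rw [← Nat.card_prod]
  refine Nat.card_eq_of_bijective (fun XY => (XY.1.2 * P XY.1.1, ⟨coeffs XY.1.1, ?_, ?_⟩)) ⟨?_, ?_⟩
  · rw [← hcoeffs, eval_zero_charpoly_ne_zero_iff]
    exact Units.isUnit _
  · rw [← hcoeffs]
    exact XY.2.2
  · rintro ⟨⟨X, Y⟩, hXY, hX⟩ ⟨⟨X', Y'⟩, hXY', hX'⟩ h
    simp only [Prod.mk.injEq, Subtype.mk.injEq] at h hX hX' hXY hXY'
    obtain ⟨h1, h2⟩ := h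
    have key {X Y : GL (Fin 3) F} (hXY : Commute X Y)
        (hX : Squarefree (X : Matrix (Fin 3) (Fin 3) F).charpoly) :
        ((Y * P X : GL (Fin 3) F) : Matrix (Fin 3) (Fin 3) F) * companionCubic (coeffs X)
          = X * (Y * P X : GL (Fin 3) F) := by
      have hc : Commute (X : Matrix (Fin 3) (Fin 3) F) Y := hXY.map (Units.coeHom _)
      rw [Units.val_mul, mul_assoc, hPX X hX, ← mul_assoc, ← hc.eq, mul_assoc]
    have h3 : X = X' := by
      have e1 := key hXY hX
      have e2 := key hXY' hX'
      rw [h1, h2, e2] at e1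
      exact Units.ext ((Units.isUnit _).mul_right_cancel e1.symm)
    subst h3
    simpa using h1
  · rintro ⟨Q, c, hc0, hc⟩
    rw [← charpoly_companionCubic, eval_zero_charpoly_ne_zero_iff] at hc0
    rw [← charpoly_companionCubic] at hc
    obtain ⟨C₀, hC⟩ := hc0
    have hX : ((Q * C₀ * Q⁻¹ : GL (Fin 3) F) : Matrix (Fin 3) (Fin 3) F).charpoly
        = (companionCubic c).charpoly := by rw [charpoly_conj, hC]
    have hcX : coeffs (Q * C₀ * Q⁻¹) = c := monicCubic_injective (by
      rw [← hcoeffs, hX, charpoly_companionCubic])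
    have hsq : Squarefree ((Q * C₀ * Q⁻¹ : GL (Fin 3) F) : Matrix (Fin 3) (Fin 3) F).charpoly := by
      rw [hX]; exact hc
    have e := hPX (Q * C₀ * Q⁻¹) hsq
    set R := P (Q * C₀ * Q⁻¹) with hR
    rw [hcX, ← hC, ← Units.val_mul, ← Units.val_mul] at e
    have e' := Units.ext e
    refine ⟨⟨(Q * C₀ * Q⁻¹, Q * R⁻¹), ?_, hsq⟩, Prod.ext ?_ (Subtype.ext hcX)⟩
    · have e2 : C₀ * R⁻¹ = R⁻¹ * (Q * C₀ * Q⁻¹) := by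
        rw [eq_inv_mul_iff_mul_eq, ← mul_assoc, e', mul_inv_cancel_right]
      change Q * C₀ * Q⁻¹ * (Q * R⁻¹) = Q * R⁻¹ * (Q * C₀ * Q⁻¹)
      calc _ = Q * (C₀ * R⁻¹) := by group
        _ = _ := by rw [e2]; group
    · simp [← hR]

end Regular

/-! ### Block diagonal matrices -/

section Block

/-- The block diagonal matrix with blocks `A` (of size two) and `c` (of size one). -/
def blockTwoOne (A : Matrix (Fin 2) (Fin 2) F) (c : F) : Matrix (Fin 3) (Fin 3) F :=
  !![A 0 0, A 0 1, 0; A 1 0, A 1 1, 0; 0, 0, c]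

/-- `blockTwoOne` as an algebra homomorphism. -/
def blockTwoOneHom : Matrix (Fin 2) (Fin 2) F × F →ₐ[F] Matrix (Fin 3) (Fin 3) F where
  toFun x := blockTwoOne x.1 x.2
  map_one' := by ext i j; fin_cases i <;> fin_cases j <;> simp [blockTwoOne]
  map_zero' := by ext i j; fin_cases i <;> fin_cases j <;> simp [blockTwoOne]
  map_add' x y := by ext i j; fin_cases i <;> fin_cases j <;> simp [blockTwoOne]
  map_mul' x y := by
    ext i j
    fin_cases i <;> fin_cases j <;> simp [blockTwoOne, Matrix.mul_apply, Fin.sum_univ_succ]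
  commutes' r := by
    ext i j
    fin_cases i <;> fin_cases j <;> simp [blockTwoOne, Matrix.algebraMap_matrix_apply]

theorem blockTwoOneHom_apply (x : Matrix (Fin 2) (Fin 2) F × F) :
    blockTwoOneHom x = blockTwoOne x.1 x.2 := rfl

theorem blockTwoOne_injective {A A' : Matrix (Fin 2) (Fin 2) F} {c c' : F}
    (h : blockTwoOne A c = blockTwoOne A' c') : A = A' ∧ c = c' := by
  refine ⟨?_, congrFun (congrFun h 2) 2⟩
  ext i j
  fin_cases i <;> fin_cases j
  · exact congrFun (congrFun h 0) 0
  · exact congrFun (congrFun h 0) 1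
  · exact congrFun (congrFun h 1) 0
  · exact congrFun (congrFun h 1) 1

theorem blockTwoOne_mul (A A' : Matrix (Fin 2) (Fin 2) F) (c c' : F) :
    blockTwoOne A c * blockTwoOne A' c' = blockTwoOne (A * A') (c * c') :=
  (map_mul blockTwoOneHom (A, c) (A', c')).symm

theorem aeval_blockTwoOne (A : Matrix (Fin 2) (Fin 2) F) (c : F) (f : F[X]) :
    aeval (blockTwoOne A c) f = blockTwoOne (aeval A f) (f.eval c) := by
  rw [← blockTwoOneHom_apply (A, c), aeval_algHom_apply, blockTwoOneHom_apply, aeval_prod]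
  simp

theorem charpoly_blockLower (A : Matrix (Fin 2) (Fin 2) F) (c r s : F) :
    (!![A 0 0, A 0 1, 0; A 1 0, A 1 1, 0; r, s, c] : Matrix (Fin 3) (Fin 3) F).charpoly
      = A.charpoly * (X - C c) := by
  simp [Matrix.charpoly, Matrix.charmatrix, Matrix.det_fin_three, Matrix.det_fin_two]
  ring

theorem charpoly_blockTwoOne (A : Matrix (Fin 2) (Fin 2) F) (c : F) :
    (blockTwoOne A c).charpoly = A.charpoly * (X - C c) :=
  charpoly_blockLower A c 0 0

theorem eval_charpoly_fin_two (A : Matrix (Fin 2) (Fin 2) F) (b : F) :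
    A.charpoly.eval b = (A 0 0 - b) * (A 1 1 - b) - A 0 1 * A 1 0 := by
  rw [Matrix.eval_charpoly, Matrix.det_fin_two]
  simp
  ring

theorem exists_mulVec_single_eq {v : Fin 3 → F} (hv : v ≠ 0) :
    ∃ P : GL (Fin 3) F, ∀ i, (P : Matrix (Fin 3) (Fin 3) F) i 2 = v i := by
  suffices ∃ M : Matrix (Fin 3) (Fin 3) F, M.det ≠ 0 ∧ ∀ i, M i 2 = v i by
    obtain ⟨M, hM, h⟩ := this
    exact ⟨Matrix.GeneralLinearGroup.mkOfDetNeZero M hM, h⟩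
  by_cases h2 : v 2 = 0
  · by_cases h1 : v 1 = 0
    · have h0 : v 0 ≠ 0 := fun h0 => hv (by ext i; fin_cases i <;> assumption)
      refine ⟨!![0, 0, v 0; 1, 0, v 1; 0, 1, v 2], by simpa [Matrix.det_fin_three], fun i => ?_⟩
      fin_cases i <;> rfl
    · refine ⟨!![1, 0, v 0; 0, 0, v 1; 0, 1, v 2], by simpa [Matrix.det_fin_three], fun i => ?_⟩
      fin_cases i <;> rfl
  · refine ⟨!![1, 0, v 0; 0, 1, v 1; 0, 0, v 2], by simpa [Matrix.det_fin_three], fun i => ?_⟩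
    fin_cases i <;> rfl

theorem exists_blockLower_conj_blockTwoOne (A : Matrix (Fin 2) (Fin 2) F) (b r s : F)
    (h : A.charpoly.eval b ≠ 0) : ∃ P : GL (Fin 3) F,
      !![A 0 0, A 0 1, 0; A 1 0, A 1 1, 0; r, s, b] * (P : Matrix (Fin 3) (Fin 3) F)
        = P * blockTwoOne A b := by
  rw [eval_charpoly_fin_two] at h
  set D := (A 0 0 - b) * (A 1 1 - b) - A 0 1 * A 1 0 with hD
  let x := (r * (A 1 1 - b) - s * A 1 0) / D
  let y := (s * (A 0 0 - b) - r * A 0 1) / D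
  have h1 : r + b * x = x * A 0 0 + y * A 1 0 := by
    simp only [x, y]; field_simp; rw [hD]; ring
  have h2 : s + b * y = x * A 0 1 + y * A 1 1 := by
    simp only [x, y]; field_simp; rw [hD]; ring
  refine ⟨Matrix.GeneralLinearGroup.mkOfDetNeZero !![1, 0, 0; 0, 1, 0; x, y, 1]
    (by simp [Matrix.det_fin_three]), ?_⟩
  ext i j
  fin_cases i <;> fin_cases j <;>
    simp [blockTwoOne, Matrix.mul_apply, Fin.sum_univ_three,
      Matrix.GeneralLinearGroup.mkOfDetNeZero,
      h1, h2]

theorem exists_conj_blockTwoOne {M : Matrix (Fin 3) (Fin 3) F} {g : F[X]} {b : F}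
    (h : M.charpoly = g * (X - C b)) (hg : g.eval b ≠ 0) :
    ∃ (P : GL (Fin 3) F) (A : Matrix (Fin 2) (Fin 2) F), A.charpoly = g ∧
      (P : Matrix (Fin 3) (Fin 3) F) * blockTwoOne A b * (P⁻¹ : GL (Fin 3) F) = M := by
  have hdet : (Matrix.scalar (Fin 3) b - M).det = 0 := by
    rw [← Matrix.eval_charpoly, h]; simp
  obtain ⟨v, hv, hMv⟩ := Matrix.exists_mulVec_eq_zero_iff.2 hdet
  obtain ⟨P, hP⟩ := exists_mulVec_single_eq hv
  set N : Matrix (Fin 3) (Fin 3) F := (P⁻¹ : GL (Fin 3) F) * M * P with hN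
  have hPN : (P : Matrix (Fin 3) (Fin 3) F) * N = M * P := by
    rw [hN, ← mul_assoc, ← mul_assoc, Units.mul_inv, one_mul]
  have hN2 (i : Fin 3) : N i 2 = if i = 2 then b else 0 := by
    have hMP (i : Fin 3) : (M * (P : Matrix (Fin 3) (Fin 3) F)) i 2 = b * v i := by
      have := congrFun hMv i
      simp only [Matrix.sub_mulVec, Matrix.scalar_apply, Pi.sub_apply, Pi.zero_apply,
        Matrix.mulVec_diagonal, sub_eq_zero] at this
      rw [this, Matrix.mul_apply]
      simp only [hP]
      rfl
    have hcol : (P⁻¹ : GL (Fin 3) F).val *ᵥ v = Pi.single 2 1 := by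
      have : v = (P : Matrix (Fin 3) (Fin 3) F) *ᵥ Pi.single 2 1 := by
        ext i; rw [← hP]; simp
      rw [this, Matrix.mulVec_mulVec, Units.inv_mul, Matrix.one_mulVec]
    have h3 := congrFun hcol i
    rw [hN, mul_assoc, Matrix.mul_apply]
    simp only [hMP]
    calc _ = b * ((P⁻¹ : GL (Fin 3) F).val *ᵥ v) i := by
          rw [Matrix.mulVec, dotProduct, Finset.mul_sum]
          exact Finset.sum_congr rfl fun j _ => by ring
      _ = _ := by rw [h3]; simp [Pi.single_apply]
  let A : Matrix (Fin 2) (Fin 2) F := !![N 0 0, N 0 1; N 1 0, N 1 1]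
  have hNA : N = !![A 0 0, A 0 1, 0; A 1 0, A 1 1, 0; N 2 0, N 2 1, b] := by
    ext i j
    fin_cases i <;> fin_cases j <;> simp [A, hN2]
  have hcharN : N.charpoly = M.charpoly := by
    have := charpoly_units_mul_mul_inv P⁻¹ M
    rwa [inv_inv] at this
  have hA : A.charpoly = g := by
    refine mul_right_cancel₀ (X_sub_C_ne_zero b) ?_
    rw [← h, ← hcharN, hNA]
    exact (charpoly_blockLower A b _ _).symm
  obtain ⟨Q, hQ⟩ := exists_blockLower_conj_blockTwoOne A b (N 2 0) (N 2 1) (hA ▸ hg)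
  rw [← hNA] at hQ
  refine ⟨P * Q, A, hA, ?_⟩
  have hPQ : ((P * Q : GL (Fin 3) F) : Matrix (Fin 3) (Fin 3) F) * blockTwoOne A b =
      M * (P * Q : GL (Fin 3) F) := by
    rw [Units.val_mul, mul_assoc, ← hQ, ← mul_assoc, hPN, mul_assoc]
  rw [hPQ, Units.mul_inv_cancel_right]

/-- `blockTwoOne` on invertible matrices. -/
def blockTwoOneGL : GL (Fin 2) F × Fˣ →* GL (Fin 3) F :=
  (Units.map (blockTwoOneHom (F := F) : Matrix (Fin 2) (Fin 2) F × F →*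
      Matrix (Fin 3) (Fin 3) F)).comp
    MulEquiv.prodUnits.symm.toMonoidHom

theorem coe_blockTwoOneGL (x : GL (Fin 2) F × Fˣ) :
    (blockTwoOneGL x : Matrix (Fin 3) (Fin 3) F) =
      blockTwoOne (x.1 : Matrix (Fin 2) (Fin 2) F) (x.2 : F) := rfl

theorem blockTwoOneGL_injective : Function.Injective (blockTwoOneGL (F := F)) := by
  rintro ⟨A, c⟩ ⟨A', c'⟩ h
  obtain ⟨h1, h2⟩ := blockTwoOne_injective (congrArg Units.val h)
  exact Prod.ext (Units.ext h1) (Units.ext h2)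

theorem card_range_blockTwoOneGL :
    Nat.card (blockTwoOneGL (F := F)).range = Nat.card (GL (Fin 2) F) * Nat.card Fˣ := by
  rw [← Nat.card_prod]
  exact (Nat.card_congr (MonoidHom.ofInjective blockTwoOneGL_injective).toEquiv).symm

theorem isUnit_of_blockTwoOne {A : Matrix (Fin 2) (Fin 2) F} {c : F}
    (h : IsUnit (blockTwoOne A c)) : ∃ x : GL (Fin 2) F × Fˣ, x.1.val = A ∧ x.2.val = c := by
  rw [Matrix.isUnit_iff_isUnit_det] at h
  have hdet : (blockTwoOne A c).det = A.det * c := by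
    simp [blockTwoOne, Matrix.det_fin_three, Matrix.det_fin_two]; ring
  rw [hdet, IsUnit.mul_iff, ← Matrix.isUnit_iff_isUnit_det] at h
  exact ⟨(h.1.unit, h.2.unit), rfl, rfl⟩

theorem mem_range_blockTwoOneGL {P : GL (Fin 3) F} {A A' : Matrix (Fin 2) (Fin 2) F} {b : F}
    (hA : A.charpoly.eval b ≠ 0) (hA' : A'.charpoly.eval b ≠ 0)
    (h : (P : Matrix (Fin 3) (Fin 3) F) * blockTwoOne A b = blockTwoOne A' b * P) :
    P ∈ (blockTwoOneGL (F := F)).range := by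
  rw [eval_charpoly_fin_two] at hA hA'
  obtain ⟨M, hM⟩ : ∃ M : Matrix (Fin 3) (Fin 3) F, M = P := ⟨_, rfl⟩
  rw [← hM] at h
  have e (i j : Fin 3) := congrFun (congrFun h i) j
  have e02 := e 0 2
  have e12 := e 1 2
  have e20 := e 2 0
  have e21 := e 2 1
  simp [blockTwoOne, Matrix.mul_apply, Fin.sum_univ_three] at e02 e12 e20 e21
  have h02 : M 0 2 = 0 := (mul_eq_zero.1 (by
    linear_combination -(A' 1 1 - b) * e02 + A' 0 1 * e12)).resolve_left hA'
  have h12 : M 1 2 = 0 := (mul_eq_zero.1 (by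
    linear_combination -(A' 0 0 - b) * e12 + A' 1 0 * e02)).resolve_left hA'
  have h20 : M 2 0 = 0 := (mul_eq_zero.1 (by
    linear_combination (A 1 1 - b) * e20 - A 1 0 * e21)).resolve_left hA
  have h21 : M 2 1 = 0 := (mul_eq_zero.1 (by
    linear_combination (A 0 0 - b) * e21 - A 0 1 * e20)).resolve_left hA
  have hb : M = blockTwoOne !![M 0 0, M 0 1; M 1 0, M 1 1] (M 2 2) := by
    ext i j
    fin_cases i <;> fin_cases j <;> simp [blockTwoOne, h02, h12, h20, h21]
  obtain ⟨x, h1, h2⟩ := isUnit_of_blockTwoOne (hb ▸ hM ▸ P.isUnit)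
  exact ⟨x, Units.ext (by rw [coe_blockTwoOneGL, h1, h2, ← hb, hM])⟩

/-- The number of matrices conjugate to a block diagonal matrix whose two blocks have coprime
characteristic polynomials. -/
theorem card_conj_blockTwoOne [Finite F] (b : F) (S : Set (Matrix (Fin 2) (Fin 2) F))
    (hS : ∀ A ∈ S, A.charpoly.eval b ≠ 0)
    (hconj : ∀ (P : GL (Fin 2) F), ∀ A ∈ S,
      (P : Matrix (Fin 2) (Fin 2) F) * A * (P⁻¹ : GL (Fin 2) F) ∈ S)
    (T : Set (Matrix (Fin 3) (Fin 3) F))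
    (hT : ∀ M, M ∈ T ↔ ∃ (P : GL (Fin 3) F), ∃ A ∈ S,
      (P : Matrix (Fin 3) (Fin 3) F) * blockTwoOne A b * (P⁻¹ : GL (Fin 3) F) = M) :
    Nat.card T * (Nat.card (GL (Fin 2) F) * Nat.card Fˣ) =
      Nat.card (GL (Fin 3) F) * Nat.card S := by
  have key := card_mul_card_of_action
    (fun (P : GL (Fin 3) F) (M : Matrix (Fin 3) (Fin 3) F) =>
      (P : Matrix (Fin 3) (Fin 3) F) * M * (P⁻¹ : GL (Fin 3) F))
    (by simp) (fun g h a => by simp only [_root_.mul_inv_rev, Units.val_mul, mul_assoc])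
    (blockTwoOneGL (F := F)).range (Set.image (fun A => blockTwoOne A b) S) T
    (by
      rintro _ ⟨⟨P, c⟩, rfl⟩ _ ⟨A, hA, rfl⟩
      refine ⟨_, hconj P A hA, ?_⟩
      simp only
      rw [← map_inv, coe_blockTwoOneGL, coe_blockTwoOneGL, blockTwoOne_mul, blockTwoOne_mul]
      simp [mul_comm (c : F) b])
    (by
      rintro P _ ⟨A, hA, rfl⟩ ⟨A', hA', h⟩
      refine mem_range_blockTwoOneGL (hS A hA) (hS A' hA') ?_
      simp only at h
      rw [h, mul_assoc, Units.inv_mul, mul_one])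
    (by
      intro M
      rw [hT]
      simp)
  rw [card_range_blockTwoOneGL] at key
  rw [key, Nat.card_image_of_injective fun A A' h => (blockTwoOne_injective h).1]

end Block

/-! ### Counting matrices by their characteristic polynomial -/

theorem card_eval_charpoly_ne_zero (n : ℕ) (a : F) :
    Nat.card {M : Matrix (Fin n) (Fin n) F // M.charpoly.eval a ≠ 0}
      = Nat.card (GL (Fin n) F) := by
  have e : {M : Matrix (Fin n) (Fin n) F // M.charpoly.eval a ≠ 0} ≃
      {M : Matrix (Fin n) (Fin n) F // IsUnit M} :=
    (Equiv.subLeft (Matrix.scalar (Fin n) a)).subtypeEquiv fun M => by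
      rw [Matrix.eval_charpoly, Matrix.isUnit_iff_isUnit_det, isUnit_iff_ne_zero]; rfl
  rw [Nat.card_congr e]
  exact Nat.card_congr Submonoid.unitsTypeEquivIsUnitSubmonoid.toEquiv.symm

theorem charpoly_fin_two_eq_sq_iff (A : Matrix (Fin 2) (Fin 2) F) (a : F) :
    A.charpoly = (X - C a) ^ 2 ↔
      A 1 1 = 2 * a - A 0 0 ∧ (A 0 0 - a) ^ 2 + A 0 1 * A 1 0 = 0 := by
  have hp : (X - C a) ^ 2 = X ^ 2 - C (2 * a) * X + C (a ^ 2) := by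
    simp only [map_mul, map_pow, map_ofNat]; ring
  rw [hp, Matrix.charpoly_fin_two, Matrix.trace_fin_two, Matrix.det_fin_two]
  constructor
  · intro h
    have h1 := congrArg (coeff · 1) h
    have h0 := congrArg (coeff · 0) h
    simp [coeff_X, -map_pow, coeff_C] at h1 h0
    refine ⟨by linear_combination -h1, ?_⟩
    linear_combination -A 0 0 * h1 - h0
  · rintro ⟨h1, h2⟩
    congr 1
    · rw [h1]; congr 3; ring
    · rw [h1]; congr 1; linear_combination -h2

open Classical in
theorem card_charpoly_eq_sq (a : F) :
    Nat.card {A : Matrix (Fin 2) (Fin 2) F // A.charpoly = (X - C a) ^ 2} = Nat.card F ^ 2 := by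
  rw [sq (Nat.card F), ← Nat.card_prod]
  refine Nat.card_congr
    { toFun := fun A => (if A.1 0 1 = 0 then A.1 1 0 else A.1 0 0 - a, A.1 0 1)
      invFun := fun x => ⟨if x.2 = 0 then !![a, 0; x.1, a] else
          !![a + x.1, x.2; -x.1 ^ 2 / x.2, a - x.1], ?_⟩
      left_inv := ?_
      right_inv := ?_ }
  · rw [charpoly_fin_two_eq_sq_iff]
    split_ifs with h
    · simp; ring
    · simp
      constructor
      · ring
      · field_simp; ring
  · rintro ⟨A, hA⟩
    rw [charpoly_fin_two_eq_sq_iff] at hA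
    obtain ⟨h1, h2⟩ := hA
    ext i j
    by_cases h : A 0 1 = 0
    · rw [h] at h2
      have h3 : A 0 0 = a := by simpa [sub_eq_zero] using h2
      fin_cases i <;> fin_cases j <;> simp [h, h3, h1]
      ring
    · fin_cases i <;> fin_cases j <;> simp [h, h1]
      · field_simp; linear_combination -h2
      · ring
  · rintro ⟨x, y⟩
    by_cases h : y = 0 <;> simp [h]

theorem card_subtype_and_ne_add_one {α : Type*} [Finite α] (P : α → Prop) {a : α} (ha : P a) :
    Nat.card {x // P x ∧ x ≠ a} + 1 = Nat.card {x // P x} := by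
  have h := Nat.card_subtype_eq_add P (· = a)
  have h1 : Nat.card {x // P x ∧ x = a} = 1 := by
    rw [Nat.card_eq_one_iff_unique]
    exact ⟨⟨fun x y => Subtype.ext (x.2.2.trans y.2.2.symm)⟩, ⟨⟨a, ha, rfl⟩⟩⟩
  rw [h, h1, add_comm]

theorem charpoly_scalar (n : ℕ) (a : F) :
    (Matrix.scalar (Fin n) a).charpoly = (X - C a) ^ n := by
  simp [Matrix.scalar_apply, Matrix.charpoly_diagonal]

theorem squarefree_minpoly_iff_aeval_eq_zero {n : ℕ} {M : Matrix (Fin n) (Fin n) F} {h : F[X]}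
    (hh : Squarefree h) {k : ℕ} (hk : k ≠ 0) (hM : M.charpoly ∣ h ^ k) :
    Squarefree (minpoly F M) ↔ aeval M h = 0 := by
  constructor
  · intro hs
    refine (minpoly.dvd_iff).1 ?_
    exact (hs.dvd_pow_iff_dvd hk).1 ((M.minpoly_dvd_charpoly).trans hM)
  · intro h0
    exact hh.squarefree_of_dvd (minpoly.dvd F M h0)

theorem aeval_X_sub_C_eq_zero_iff {n : ℕ} (M : Matrix (Fin n) (Fin n) F) (a : F) :
    aeval M (X - C a) = 0 ↔ M = Matrix.scalar (Fin n) a := by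
  rw [map_sub, aeval_X, aeval_C, sub_eq_zero]; rfl

theorem squarefree_minpoly_iff_eq_scalar {n : ℕ} {M : Matrix (Fin n) (Fin n) F} {a : F}
    {k : ℕ} (hk : k ≠ 0) (hM : M.charpoly = (X - C a) ^ k) :
    Squarefree (minpoly F M) ↔ M = Matrix.scalar (Fin n) a := by
  rw [squarefree_minpoly_iff_aeval_eq_zero (irreducible_X_sub_C a).squarefree hk hM.dvd,
    aeval_X_sub_C_eq_zero_iff]

theorem squarefree_X_sub_C_mul {a b : F} (hab : a ≠ b) : Squarefree ((X - C a) * (X - C b)) := by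
  rw [squarefree_mul_iff]
  exact ⟨(isCoprime_X_sub_C_of_isUnit_sub (sub_ne_zero.2 hab).isUnit).isRelPrime,
    (irreducible_X_sub_C a).squarefree, (irreducible_X_sub_C b).squarefree⟩

theorem minpoly_units_mul_mul_inv {n : ℕ} (P : GL (Fin n) F) (M : Matrix (Fin n) (Fin n) F) :
    minpoly F ((P : Matrix (Fin n) (Fin n) F) * M * (P⁻¹ : GL (Fin n) F)) = minpoly F M :=
  minpoly.algEquiv_eq (MulSemiringAction.toAlgEquiv F (Matrix (Fin n) (Fin n) F)
    (ConjAct.toConjAct P)) M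

theorem squarefree_minpoly_conj_blockTwoOne_iff {a b : F} (hab : a ≠ b) {P : GL (Fin 3) F}
    {A : Matrix (Fin 2) (Fin 2) F} (hA : A.charpoly = (X - C a) ^ 2) :
    Squarefree (minpoly F ((P : Matrix (Fin 3) (Fin 3) F) * blockTwoOne A b *
      (P⁻¹ : GL (Fin 3) F))) ↔ A = Matrix.scalar (Fin 2) a := by
  rw [minpoly_units_mul_mul_inv, squarefree_minpoly_iff_aeval_eq_zero
    (squarefree_X_sub_C_mul hab) two_ne_zero, aeval_blockTwoOne, ← aeval_X_sub_C_eq_zero_iff]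
  · have hu : IsUnit (aeval A (X - C b)) := by
      rw [Matrix.isUnit_iff_isUnit_det, isUnit_iff_ne_zero]
      have : A.charpoly.eval b ≠ 0 := by simpa [hA, sub_eq_zero] using hab.symm
      rw [eval_charpoly_fin_two] at this
      rw [Matrix.det_fin_two]
      simpa [Matrix.algebraMap_matrix_apply] using this
    rw [← hu.mul_left_eq_zero, ← map_mul]
    constructor
    · intro h
      exact (blockTwoOne_injective (h.trans (map_zero blockTwoOneHom).symm)).1
    · intro h
      rw [h]
      simp only [eval_mul, eval_sub, eval_X, eval_C, sub_self, mul_zero]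
      exact map_zero (blockTwoOneHom (F := F))
  · rw [charpoly_blockTwoOne, hA, mul_pow]
    exact mul_dvd_mul_left _ (dvd_pow_self _ two_ne_zero)

theorem card_units_subtype {M : Type*} [Monoid M] (P : M → Prop) (h : ∀ x, P x → IsUnit x) :
    Nat.card {x : Mˣ // P x} = Nat.card {x // P x} :=
  Nat.card_eq_of_bijective (fun x => ⟨x.1, x.2⟩)
    ⟨fun _ _ h => Subtype.ext (Units.ext (congrArg Subtype.val h)),
      fun x => ⟨⟨(h x x.2).unit, x.2⟩, rfl⟩⟩

theorem card_charpoly_eq_sq_and_ne [Finite F] (a : F) :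
    Nat.card {A : Matrix (Fin 2) (Fin 2) F // A.charpoly = (X - C a) ^ 2 ∧
      A ≠ Matrix.scalar (Fin 2) a} + 1 = Nat.card F ^ 2 := by
  rw [card_subtype_and_ne_add_one (fun A : Matrix (Fin 2) (Fin 2) F => A.charpoly = (X - C a) ^ 2)
    (charpoly_scalar 2 a), card_charpoly_eq_sq]

theorem isUnit_of_charpoly_eq_X_sub_C_pow {n k : ℕ} {M : Matrix (Fin n) (Fin n) F} {a : Fˣ}
    (h : M.charpoly = (X - C (a : F)) ^ k) : IsUnit M := by
  rw [← eval_zero_charpoly_ne_zero_iff, h]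
  simp

theorem X_sub_C_units_sq_injective :
    Function.Injective fun a : Fˣ => (X - C (a : F)) ^ 2 := fun a b h => by
  have h1 := congrArg (eval (a : F)) h
  simp only [eval_pow, eval_sub, eval_X, eval_C, sub_self] at h1
  exact Units.ext (sub_eq_zero.1 (pow_eq_zero_iff two_ne_zero |>.1 (h1.symm.trans (by simp))))

theorem card_squarefree_minpoly_GL_two [Finite F] :
    Nat.card {Y : GL (Fin 2) F // Squarefree (minpoly F (Y : Matrix (Fin 2) (Fin 2) F))}
      + Nat.card Fˣ * Nat.card F ^ 2 = Nat.card (GL (Fin 2) F) + Nat.card Fˣ := by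
  have := Fintype.ofFinite Fˣ
  have h1 := Nat.card_subtype_eq_add (fun _ : GL (Fin 2) F => True)
    (fun Y => Squarefree (minpoly F (Y : Matrix (Fin 2) (Fin 2) F)))
  have h2 : ∀ Y : GL (Fin 2) F, (True ∧ ¬ Squarefree (minpoly F (Y : Matrix (Fin 2) (Fin 2) F))) ↔
      (¬ Squarefree (minpoly F (Y : Matrix (Fin 2) (Fin 2) F)) ∧
        ∃ a : Fˣ, (Y : Matrix (Fin 2) (Fin 2) F).charpoly = (X - C (a : F)) ^ 2) := by
    refine fun Y => ⟨fun h => ⟨h.2, ?_⟩, fun h => ⟨trivial, h.1⟩⟩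
    obtain ⟨a, ha⟩ := exists_eq_X_sub_C_sq (Matrix.charpoly_monic _)
      (by rw [Matrix.charpoly_natDegree_eq_dim, Fintype.card_fin])
      (mt squarefree_minpoly_of_squarefree_charpoly h.2)
    have h0 := (eval_zero_charpoly_ne_zero_iff (Y : Matrix (Fin 2) (Fin 2) F)).2 Y.isUnit
    have ha0 : a ≠ 0 := by
      rintro rfl
      simp [ha] at h0
    exact ⟨Units.mk0 a ha0, ha⟩
  have h3 (a : Fˣ) : Nat.card {Y : GL (Fin 2) F //
      ¬ Squarefree (minpoly F (Y : Matrix (Fin 2) (Fin 2) F)) ∧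
        (Y : Matrix (Fin 2) (Fin 2) F).charpoly = (X - C (a : F)) ^ 2} + 1 = Nat.card F ^ 2 := by
    rw [← card_charpoly_eq_sq_and_ne (a : F), ← card_units_subtype _
      fun A h => isUnit_of_charpoly_eq_X_sub_C_pow h.1]
    congr 1
    refine Nat.card_congr (Equiv.subtypeEquivRight fun Y => ?_)
    rw [and_comm]
    refine and_congr_right fun h => ?_
    rw [squarefree_minpoly_iff_eq_scalar two_ne_zero h]
  rw [Nat.card_congr (Equiv.subtypeEquivRight h2),
    Nat.card_subtype_exists_eq_sum _ (fun Y : GL (Fin 2) F =>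
      (Y : Matrix (Fin 2) (Fin 2) F).charpoly) _ X_sub_C_units_sq_injective] at h1
  simp only [true_and] at h1
  have h4 : Nat.card {_Y : GL (Fin 2) F // True} = Nat.card (GL (Fin 2) F) :=
    Nat.card_congr (Equiv.subtypeUnivEquiv fun _ => trivial)
  rw [← h4, h1, add_assoc]
  congr 1
  have h5 := Finset.sum_congr (rfl : (Finset.univ : Finset Fˣ) = _) fun a _ => h3 a
  rw [Finset.sum_add_distrib] at h5
  simpa using h5.symm

theorem card_conj_blockTwoOne_of_charpoly [Finite F] (b : F)
    (S : Set (Matrix (Fin 2) (Fin 2) F)) (T : Set (Matrix (Fin 3) (Fin 3) F)) (p : F[X] → Prop)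
    (hp : ∀ g, p g → g.eval b ≠ 0) (hS : ∀ A, A ∈ S ↔ p A.charpoly)
    (hT : ∀ M, M ∈ T ↔ ∃ g, p g ∧ M.charpoly = g * (X - C b)) :
    Nat.card T * (Nat.card (GL (Fin 2) F) * Nat.card Fˣ)
      = Nat.card (GL (Fin 3) F) * Nat.card S := by
  refine card_conj_blockTwoOne b S (fun A hA => hp _ ((hS A).1 hA)) (fun P A hA => ?_) T
    fun M => ?_
  · rw [hS, charpoly_units_mul_mul_inv, ← hS]
    exact hA
  · rw [hT]
    constructor
    · rintro ⟨g, hg, h⟩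
      obtain ⟨P, A, hA, hP⟩ := exists_conj_blockTwoOne h (hp g hg)
      exact ⟨P, A, (hS A).2 (hA ▸ hg), hP⟩
    · rintro ⟨P, A, hA, rfl⟩
      exact ⟨A.charpoly, (hS A).1 hA, by rw [charpoly_units_mul_mul_inv, charpoly_blockTwoOne]⟩

theorem card_charpoly_eq_doubleRootCubic_of_ne [Finite F] {a b : F} (hab : a ≠ b) :
    Nat.card {M : Matrix (Fin 3) (Fin 3) F // M.charpoly = doubleRootCubic a b}
        * (Nat.card (GL (Fin 2) F) * Nat.card Fˣ)
      = Nat.card (GL (Fin 3) F) * Nat.card F ^ 2 := by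
  rw [← card_charpoly_eq_sq a]
  refine card_conj_blockTwoOne_of_charpoly b {A | A.charpoly = (X - C a) ^ 2}
    {M | M.charpoly = doubleRootCubic a b} (· = (X - C a) ^ 2) ?_ (fun A => Iff.rfl) fun M => ?_
  · rintro _ rfl
    simpa [sub_eq_zero] using hab.symm
  · simp [doubleRootCubic]

theorem card_simple_root_charpoly [Finite F] (b : F) :
    Nat.card {M : Matrix (Fin 3) (Fin 3) F // ∃ g, g.eval b ≠ 0 ∧ M.charpoly = g * (X - C b)}
        * (Nat.card (GL (Fin 2) F) * Nat.card Fˣ)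
      = Nat.card (GL (Fin 3) F) * Nat.card (GL (Fin 2) F) := by
  refine Eq.trans ?_ (congrArg _ (card_eval_charpoly_ne_zero 2 b))
  exact card_conj_blockTwoOne_of_charpoly b {A | A.charpoly.eval b ≠ 0}
    {M | ∃ g, g.eval b ≠ 0 ∧ M.charpoly = g * (X - C b)} (fun g => g.eval b ≠ 0)
    (fun _ h => h) (fun A => Iff.rfl) fun M => Iff.rfl

theorem card_not_squarefree_minpoly_of_ne [Finite F] {a b : F} (hab : a ≠ b) :
    Nat.card {M : Matrix (Fin 3) (Fin 3) F // M.charpoly = doubleRootCubic a b ∧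
        ¬ Squarefree (minpoly F M)} * (Nat.card (GL (Fin 2) F) * Nat.card Fˣ)
      + Nat.card (GL (Fin 3) F) = Nat.card (GL (Fin 3) F) * Nat.card F ^ 2 := by
  rw [← card_charpoly_eq_sq_and_ne a, mul_add_one]
  congr 1
  refine card_conj_blockTwoOne b {A | A.charpoly = (X - C a) ^ 2 ∧ A ≠ Matrix.scalar (Fin 2) a}
    ?_ ?_ {M | M.charpoly = doubleRootCubic a b ∧ ¬ Squarefree (minpoly F M)} fun M => ?_
  · rintro A ⟨hA, -⟩
    simpa [hA, sub_eq_zero] using hab.symm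
  · rintro P A ⟨hA, hA'⟩
    have h : ((P : Matrix (Fin 2) (Fin 2) F) * A * (P⁻¹ : GL (Fin 2) F)).charpoly
        = (X - C a) ^ 2 := by rw [charpoly_units_mul_mul_inv, hA]
    refine ⟨h, ?_⟩
    rw [Ne, ← squarefree_minpoly_iff_eq_scalar two_ne_zero h, minpoly_units_mul_mul_inv,
      squarefree_minpoly_iff_eq_scalar two_ne_zero hA]
    exact hA'
  · constructor
    · rintro ⟨h, hM⟩
      obtain ⟨P, A, hA, rfl⟩ := exists_conj_blockTwoOne h
        (by simpa [sub_eq_zero] using hab.symm)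
      rw [squarefree_minpoly_conj_blockTwoOne_iff hab hA] at hM
      exact ⟨P, A, ⟨hA, hM⟩, rfl⟩
    · rintro ⟨P, A, ⟨hA, hA'⟩, rfl⟩
      refine ⟨by rw [charpoly_units_mul_mul_inv, charpoly_blockTwoOne, hA, doubleRootCubic], ?_⟩
      rwa [squarefree_minpoly_conj_blockTwoOne_iff hab hA]

theorem exists_eq_mul_or_eq_doubleRootCubic {f : F[X]} (hf : f.Monic) (hdeg : f.natDegree = 3)
    {a : F} (ha : f.eval a = 0) (h : ¬ ∃ g, g.eval a ≠ 0 ∧ f = g * (X - C a)) :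
    ∃ b, f = doubleRootCubic a b := by
  obtain ⟨g, rfl⟩ := dvd_iff_isRoot.2 ha
  have hga : g.eval a = 0 := by
    by_contra hga
    exact h ⟨g, hga, mul_comm _ _⟩
  obtain ⟨g, rfl⟩ := dvd_iff_isRoot.2 hga
  rw [← mul_assoc, ← sq] at hf hdeg ⊢
  have hg : g.Monic := ((monic_X_sub_C a).pow 2).of_mul_monic_left hf
  rw [natDegree_X_sub_C_sq_mul a hg] at hdeg
  obtain ⟨b, rfl⟩ := exists_eq_X_sub_C hg (by omega)
  exact ⟨b, rfl⟩

theorem card_units_add_one [Finite F] : Nat.card Fˣ + 1 = Nat.card F := by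
  have := Nat.card_units F
  have := Nat.card_pos (α := F)
  omega

theorem cast_card_GL [Finite F] (n : ℕ) : (Nat.card (GL (Fin n) F) : ℤ)
    = ∏ i : Fin n, ((Nat.card F : ℤ) ^ n - (Nat.card F : ℤ) ^ (i : ℕ)) := by
  have := Fintype.ofFinite F
  rw [Matrix.card_GL_field, Nat.cast_prod, ← Nat.card_eq_fintype_card]
  refine Finset.prod_congr rfl fun i _ => ?_
  rw [Nat.cast_sub (Nat.pow_le_pow_right Nat.card_pos i.2.le), Nat.cast_pow, Nat.cast_pow]

theorem card_GL_two [Finite F] : (Nat.card (GL (Fin 2) F) : ℤ)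
    = ((Nat.card F : ℤ) ^ 2 - 1) * (Nat.card F ^ 2 - Nat.card F) := by
  rw [cast_card_GL, Fin.prod_univ_two, Fin.val_zero, Fin.val_one, pow_zero, pow_one]

theorem card_GL_three [Finite F] : (Nat.card (GL (Fin 3) F) : ℤ)
    = ((Nat.card F : ℤ) ^ 3 - 1) * (Nat.card F ^ 3 - Nat.card F)
      * (Nat.card F ^ 3 - Nat.card F ^ 2) := by
  rw [cast_card_GL, Fin.prod_univ_three, Fin.val_zero, Fin.val_one, Fin.val_two, pow_zero, pow_one]

theorem card_charpoly_eq_X_sub_C_cube [Finite F] (a : F) :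
    Nat.card {M : Matrix (Fin 3) (Fin 3) F // M.charpoly = doubleRootCubic a a}
      = Nat.card F ^ 6 := by
  classical
  have := Fintype.ofFinite F
  have h1 := Nat.card_subtype_eq_add (fun _ : Matrix (Fin 3) (Fin 3) F => True)
    (fun M => M.charpoly.eval a ≠ 0)
  have h2 := Nat.card_subtype_eq_add (fun M : Matrix (Fin 3) (Fin 3) F => M.charpoly.eval a = 0)
    (fun M => ∃ g, g.eval a ≠ 0 ∧ M.charpoly = g * (X - C a))
  have h3 := Nat.card_subtype_exists_eq_sum (fun _ : Matrix (Fin 3) (Fin 3) F => True)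
    Matrix.charpoly (fun b => doubleRootCubic a b) fun b b' h => (doubleRootCubic_injective h).2
  have e0 : Nat.card {_M : Matrix (Fin 3) (Fin 3) F // True} = Nat.card F ^ 9 := by
    rw [Nat.card_congr (Equiv.subtypeUnivEquiv fun _ => trivial)]
    simp [Matrix, ← pow_mul]
  have e1 : ∀ M : Matrix (Fin 3) (Fin 3) F, (M.charpoly.eval a = 0 ∧
      ∃ g, g.eval a ≠ 0 ∧ M.charpoly = g * (X - C a)) ↔
        ∃ g, g.eval a ≠ 0 ∧ M.charpoly = g * (X - C a) := fun M => by
    refine ⟨fun h => h.2, fun h => ⟨?_, h⟩⟩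
    obtain ⟨g, -, h⟩ := h
    simp [h]
  have e2 : ∀ M : Matrix (Fin 3) (Fin 3) F, (M.charpoly.eval a = 0 ∧
      ¬ ∃ g, g.eval a ≠ 0 ∧ M.charpoly = g * (X - C a)) ↔
        ∃ b, M.charpoly = doubleRootCubic a b := fun M => by
    constructor
    · rintro ⟨ha, h⟩
      exact exists_eq_mul_or_eq_doubleRootCubic (Matrix.charpoly_monic _)
        (by rw [Matrix.charpoly_natDegree_eq_dim, Fintype.card_fin]) ha h
    · rintro ⟨b, h⟩
      refine ⟨by simp [h, doubleRootCubic], ?_⟩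
      rintro ⟨g, hg, h'⟩
      refine hg ?_
      have : g = (X - C a) * (X - C b) := mul_right_cancel₀ (X_sub_C_ne_zero a) (by
        rw [← h', h, doubleRootCubic]; ring)
      simp [this]
  simp only [true_and, not_not] at h1 h3
  rw [Nat.card_congr (Equiv.subtypeEquivRight e1), Nat.card_congr (Equiv.subtypeEquivRight e2)]
    at h2
  rw [card_eval_charpoly_ne_zero, e0, h2, h3, ← Finset.add_sum_erase _ _ (Finset.mem_univ a)] at h1
  have h4 := card_simple_root_charpoly a
  have h5 := Finset.sum_congr (rfl : (Finset.univ.erase a) = _) fun b hb =>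
    card_charpoly_eq_doubleRootCubic_of_ne (Finset.ne_of_mem_erase hb).symm
  rw [← Finset.sum_mul, Finset.sum_const, smul_eq_mul, Finset.card_erase_of_mem (Finset.mem_univ a),
    Finset.card_univ, ← Nat.card_eq_fintype_card, ← card_units_add_one (F := F), Nat.add_sub_cancel,
    card_units_add_one] at h5
  set s := ∑ b ∈ Finset.univ.erase a,
    Nat.card {M : Matrix (Fin 3) (Fin 3) F // M.charpoly = doubleRootCubic a b}
  have hpos : Nat.card (GL (Fin 2) F) * Nat.card Fˣ ≠ 0 :=
    (Nat.mul_pos Nat.card_pos Nat.card_pos).ne'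
  have hq : (Nat.card Fˣ : ℤ) = Nat.card F - 1 := by
    rw [← card_units_add_one (F := F)]; push_cast; ring
  have g2 := card_GL_two (F := F)
  have g3 := card_GL_three (F := F)
  zify at h1 h4 h5 hpos ⊢
  refine mul_right_cancel₀ hpos ?_
  have h6 := congrArg (· * ((Nat.card (GL (Fin 2) F) : ℤ) * Nat.card Fˣ)) h1
  simp only [add_mul] at h6
  rw [h4, h5] at h6
  rw [g2, g3, hq] at h6
  rw [g2, hq]
  linear_combination -h6

theorem cast_eq_mul_of_mul_card_eq [Finite F] {x y : ℕ}
    (h : x * (Nat.card (GL (Fin 2) F) * Nat.card Fˣ) = Nat.card (GL (Fin 3) F) * y) :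
    (x : ℤ) = Nat.card F ^ 2 * (Nat.card F ^ 2 + Nat.card F + 1) * y := by
  have hpos : Nat.card (GL (Fin 2) F) * Nat.card Fˣ ≠ 0 :=
    (Nat.mul_pos Nat.card_pos Nat.card_pos).ne'
  have hq : (Nat.card Fˣ : ℤ) = Nat.card F - 1 := by
    rw [← card_units_add_one (F := F)]; push_cast; ring
  zify at h hpos
  refine mul_right_cancel₀ hpos ?_
  rw [h, card_GL_two, card_GL_three, hq]
  ring

theorem sum_units_prod [Fintype Fˣ] (f : Fˣ × Fˣ → ℤ) (x y : ℤ)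
    (hx : ∀ a, f (a, a) = x) (hy : ∀ a b, a ≠ b → f (a, b) = y) :
    ∑ ab, f ab = Nat.card Fˣ * (x + (Nat.card Fˣ - 1) * y) := by
  classical
  have h (a : Fˣ) : ∑ b, f (a, b) = x + (Nat.card Fˣ - 1) * y := by
    rw [← Finset.add_sum_erase _ _ (Finset.mem_univ a), hx,
      Finset.sum_congr rfl fun b hb => hy a b (Finset.ne_of_mem_erase hb).symm,
      Finset.sum_const, Finset.card_erase_of_mem (Finset.mem_univ a), nsmul_eq_mul,
      Finset.card_univ, Nat.cast_sub Fintype.card_pos, Nat.card_eq_fintype_card, Nat.cast_one]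
  rw [Fintype.sum_prod_type, Finset.sum_congr rfl fun a _ => h a, Finset.sum_const, nsmul_eq_mul,
    Finset.card_univ, Nat.card_eq_fintype_card]

theorem isUnit_of_charpoly_eq_doubleRootCubic {M : Matrix (Fin 3) (Fin 3) F} {a b : Fˣ}
    (h : M.charpoly = doubleRootCubic (a : F) b) : IsUnit M := by
  rw [← eval_zero_charpoly_ne_zero_iff, h, eval_zero_doubleRootCubic]
  simp

theorem not_squarefree_charpoly_iff (X : GL (Fin 3) F) :
    ¬ Squarefree (X : Matrix (Fin 3) (Fin 3) F).charpoly ↔ ∃ ab : Fˣ × Fˣ,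
      (X : Matrix (Fin 3) (Fin 3) F).charpoly = doubleRootCubic (ab.1 : F) ab.2 :=
  not_squarefree_iff_exists_eq_doubleRootCubic (Matrix.charpoly_monic _)
    (by rw [Matrix.charpoly_natDegree_eq_dim, Fintype.card_fin])
    ((eval_zero_charpoly_ne_zero_iff _).2 X.isUnit)

theorem doubleRootCubic_self (a : F) : doubleRootCubic a a = (X - C a) ^ 3 := by
  rw [doubleRootCubic]; ring

theorem card_not_squarefree_minpoly_of_eq [Finite F] (a : F) :
    Nat.card {M : Matrix (Fin 3) (Fin 3) F // M.charpoly = doubleRootCubic a a ∧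
        ¬ Squarefree (minpoly F M)} + 1 = Nat.card F ^ 6 := by
  rw [← card_charpoly_eq_X_sub_C_cube a, ← card_subtype_and_ne_add_one
    (fun M : Matrix (Fin 3) (Fin 3) F => M.charpoly = doubleRootCubic a a)
    ((charpoly_scalar 3 a).trans (doubleRootCubic_self a).symm)]
  congr 1
  refine Nat.card_congr (Equiv.subtypeEquivRight fun M => and_congr_right fun h => ?_)
  rw [squarefree_minpoly_iff_eq_scalar three_ne_zero (h.trans (doubleRootCubic_self a))]

theorem card_squarefree_minpoly_GL_three [Finite F] :
    (Nat.card {X : GL (Fin 3) F // Squarefree (minpoly F (X : Matrix (Fin 3) (Fin 3) F))} : ℤ)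
      = Nat.card (GL (Fin 3) F) - Nat.card Fˣ * ((Nat.card F ^ 6 - 1) + (Nat.card Fˣ - 1) *
        (Nat.card F ^ 2 * (Nat.card F ^ 2 + Nat.card F + 1) * (Nat.card F ^ 2 - 1))) := by
  have := Fintype.ofFinite Fˣ
  have h1 := Nat.card_subtype_eq_add (fun _ : GL (Fin 3) F => True)
    (fun X => Squarefree (minpoly F (X : Matrix (Fin 3) (Fin 3) F)))
  have h2 : ∀ X : GL (Fin 3) F, (True ∧ ¬ Squarefree (minpoly F (X : Matrix (Fin 3) (Fin 3) F))) ↔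
      (¬ Squarefree (minpoly F (X : Matrix (Fin 3) (Fin 3) F)) ∧
        ∃ ab : Fˣ × Fˣ, (X : Matrix (Fin 3) (Fin 3) F).charpoly =
          doubleRootCubic (ab.1 : F) ab.2) := fun X =>
    ⟨fun h => ⟨h.2, (not_squarefree_charpoly_iff X).1
      (mt squarefree_minpoly_of_squarefree_charpoly h.2)⟩, fun h => ⟨trivial, h.1⟩⟩
  have h3 (a b : Fˣ) : Nat.card {X : GL (Fin 3) F //
      ¬ Squarefree (minpoly F (X : Matrix (Fin 3) (Fin 3) F)) ∧
        (X : Matrix (Fin 3) (Fin 3) F).charpoly = doubleRootCubic (a : F) b} =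
      Nat.card {M : Matrix (Fin 3) (Fin 3) F // M.charpoly = doubleRootCubic (a : F) b ∧
        ¬ Squarefree (minpoly F M)} := by
    rw [← card_units_subtype _ fun M h => isUnit_of_charpoly_eq_doubleRootCubic h.1]
    exact Nat.card_congr (Equiv.subtypeEquivRight fun X => and_comm)
  rw [Nat.card_congr (Equiv.subtypeEquivRight h2),
    Nat.card_subtype_exists_eq_sum _ (fun X : GL (Fin 3) F =>
      (X : Matrix (Fin 3) (Fin 3) F).charpoly) _ doubleRootCubic_units_injective] at h1
  simp only [true_and, h3] at h1
  have h4 : Nat.card {_X : GL (Fin 3) F // True} = Nat.card (GL (Fin 3) F) :=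
    Nat.card_congr (Equiv.subtypeUnivEquiv fun _ => trivial)
  rw [h4] at h1
  zify at h1
  rw [h1, sum_units_prod _ (Nat.card F ^ 6 - 1)
    (Nat.card F ^ 2 * (Nat.card F ^ 2 + Nat.card F + 1) * (Nat.card F ^ 2 - 1)),
    add_sub_cancel_right]
  · intro a
    rw [eq_sub_iff_add_eq]
    exact_mod_cast card_not_squarefree_minpoly_of_eq (a : F)
  · intro a b hab
    have h5 := card_not_squarefree_minpoly_of_ne (fun h => hab (Units.ext h) : (a : F) ≠ b)
    obtain ⟨m, hm⟩ : ∃ m, Nat.card F ^ 2 = m + 1 :=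
      Nat.exists_eq_add_one.2 (Nat.pow_pos Nat.card_pos)
    rw [hm, mul_add_one, Nat.add_right_cancel_iff] at h5
    rw [cast_eq_mul_of_mul_card_eq h5]
    have hm' : (Nat.card F : ℤ) ^ 2 = m + 1 := by exact_mod_cast hm
    rw [hm']; ring

section Pairs

variable {p : ℕ}

theorem coprime_orderOf_units [Finite F] (hp : p.Prime) [CharP F p] (c : Fˣ) :
    (orderOf c).Coprime p := by
  refine Nat.Coprime.coprime_dvd_left (orderOf_dvd_natCard c) ?_
  have := Fintype.ofFinite F
  rw [Nat.coprime_comm, hp.coprime_iff_not_dvd, ← CharP.cast_eq_zero_iff F p]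
  intro h
  have h1 := congrArg (Nat.cast : ℕ → F) (card_units_add_one (F := F))
  rw [Nat.cast_add, h, Nat.card_eq_fintype_card (α := F), FiniteField.cast_card_eq_zero] at h1
  simp at h1

theorem squarefree_minpoly_blockTwoOneGL_iff [Finite F] (hp : p.Prime) [CharP F p]
    (x : GL (Fin 2) F × Fˣ) :
    Squarefree (minpoly F (blockTwoOneGL x : Matrix (Fin 3) (Fin 3) F)) ↔
      Squarefree (minpoly F (x.1 : Matrix (Fin 2) (Fin 2) F)) := by
  rw [← coprime_orderOf_iff_squarefree_minpoly hp, ← coprime_orderOf_iff_squarefree_minpoly hp,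
    orderOf_injective _ blockTwoOneGL_injective, Prod.orderOf]
  refine ⟨Nat.Coprime.coprime_dvd_left (Nat.dvd_lcm_left _ _), fun h => ?_⟩
  exact Nat.Coprime.coprime_dvd_left (Nat.lcm_dvd_mul _ _)
    (h.mul_left (coprime_orderOf_units hp x.2))

theorem blockTwoOneGL_scalar_commute (a b : Fˣ) (x : GL (Fin 2) F × Fˣ) :
    Commute (blockTwoOneGL (Units.map (Matrix.scalar (Fin 2)).toMonoidHom a, b))
      (blockTwoOneGL x) := by
  refine Commute.map (Prod.ext (Units.ext ?_) (mul_comm _ _)) blockTwoOneGL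
  exact (Matrix.scalar_commute (a : F) (fun r => mul_comm _ _) _).eq

theorem card_commuting_charpoly_eq_doubleRootCubic_of_ne [Finite F] (hp : p.Prime) [CharP F p]
    {a b : Fˣ} (hab : a ≠ b) :
    Nat.card {XY : GL (Fin 3) F × GL (Fin 3) F // (Commute XY.1 XY.2 ∧
        Squarefree (minpoly F (XY.1 : Matrix (Fin 3) (Fin 3) F)) ∧
        Squarefree (minpoly F (XY.2 : Matrix (Fin 3) (Fin 3) F))) ∧
        (XY.1 : Matrix (Fin 3) (Fin 3) F).charpoly = doubleRootCubic (a : F) b}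
      * (Nat.card (GL (Fin 2) F) * Nat.card Fˣ) = Nat.card (GL (Fin 3) F) *
      (Nat.card {Y : GL (Fin 2) F // Squarefree (minpoly F (Y : Matrix (Fin 2) (Fin 2) F))}
        * Nat.card Fˣ) := by
  have hab' : (a : F) ≠ b := fun h => hab (Units.ext h)
  set s : GL (Fin 2) F := Units.map (Matrix.scalar (Fin 2)).toMonoidHom a with hs
  have hsc : (s : Matrix (Fin 2) (Fin 2) F).charpoly = (X - C (a : F)) ^ 2 :=
    charpoly_scalar 2 (a : F)
  have hse : (s : Matrix (Fin 2) (Fin 2) F).charpoly.eval (b : F) ≠ 0 := by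
    simpa [hsc, sub_eq_zero] using hab'.symm
  let S : Set (GL (Fin 2) F × Fˣ) :=
    {x | Squarefree (minpoly F (x.1 : Matrix (Fin 2) (Fin 2) F))}
  have hS : Nat.card S = Nat.card {Y : GL (Fin 2) F //
      Squarefree (minpoly F (Y : Matrix (Fin 2) (Fin 2) F))} * Nat.card Fˣ := by
    rw [← Nat.card_prod]
    exact Nat.card_eq_of_bijective (fun x => (⟨x.1.1, x.2⟩, x.1.2))
      ⟨fun x y h => by
        simp only [Prod.mk.injEq, Subtype.mk.injEq] at h
        exact Subtype.ext (Prod.ext h.1 h.2), fun y => ⟨⟨(y.1.1, y.2), y.1.2⟩, rfl⟩⟩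
  rw [← hS, ← card_range_blockTwoOneGL]
  let f : GL (Fin 2) F × Fˣ → GL (Fin 3) F × GL (Fin 3) F := fun x =>
    (blockTwoOneGL (s, b), blockTwoOneGL x)
  have hf : Function.Injective f := fun x y h => blockTwoOneGL_injective (congrArg Prod.snd h)
  rw [← Nat.card_image_of_injective hf]
  refine card_mul_card_of_action
    (fun (P : GL (Fin 3) F) (XY : GL (Fin 3) F × GL (Fin 3) F) =>
      (P * XY.1 * P⁻¹, P * XY.2 * P⁻¹)) (by simp) (fun g h x => by simp [mul_assoc])
    (blockTwoOneGL (F := F)).range (Set.image f S) {XY | (Commute XY.1 XY.2 ∧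
        Squarefree (minpoly F (XY.1 : Matrix (Fin 3) (Fin 3) F)) ∧
        Squarefree (minpoly F (XY.2 : Matrix (Fin 3) (Fin 3) F))) ∧
        (XY.1 : Matrix (Fin 3) (Fin 3) F).charpoly = doubleRootCubic (a : F) b} ?_ ?_ ?_
  · rintro _ ⟨y, rfl⟩ _ ⟨x, hx, rfl⟩
    refine ⟨y * x * y⁻¹, ?_, Prod.ext ?_ ?_⟩
    · exact (congrArg Squarefree
        (minpoly_units_mul_mul_inv y.1 (x.1 : Matrix (Fin 2) (Fin 2) F))).mpr hx
    · simp only [f]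
      rw [← (blockTwoOneGL_scalar_commute a b y).eq, mul_inv_cancel_right]
    · simp [f]
  · rintro P _ ⟨x, -, rfl⟩ ⟨y, -, h⟩
    have h1 : blockTwoOneGL (s, b) = P * blockTwoOneGL (s, b) * P⁻¹ := congrArg Prod.fst h
    rw [eq_mul_inv_iff_mul_eq] at h1
    exact mem_range_blockTwoOneGL hse hse (congrArg Units.val h1).symm
  · rintro ⟨M, N⟩
    constructor
    · rintro ⟨⟨hMN, hM, hN⟩, hc⟩
      obtain ⟨P, A, hA, hP⟩ := exists_conj_blockTwoOne hc
        (by simpa [sub_eq_zero] using hab'.symm)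
      rw [← hP, squarefree_minpoly_conj_blockTwoOne_iff hab' hA] at hM
      have hM' : P * blockTwoOneGL (s, b) * P⁻¹ = M := Units.ext (by
        rw [← hP, hM]; rfl)
      have hcomm : (P⁻¹ * N * P) * blockTwoOneGL (s, b) = blockTwoOneGL (s, b) * (P⁻¹ * N * P) := by
        have h2 : blockTwoOneGL (s, b) = P⁻¹ * M * P := by rw [← hM']; group
        have h3 : M * N = N * M := hMN
        rw [h2]
        calc _ = P⁻¹ * (N * M) * P := by group
          _ = _ := by rw [← h3]; group
      obtain ⟨x, hx⟩ := mem_range_blockTwoOneGL hse hse (congrArg Units.val hcomm)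
      have hN' : P * blockTwoOneGL x * P⁻¹ = N := by rw [hx]; group
      refine ⟨P, f x, ⟨x, ?_, rfl⟩, Prod.ext hM' hN'⟩
      have h4 := minpoly_units_mul_mul_inv P (blockTwoOneGL x : Matrix (Fin 3) (Fin 3) F)
      rw [← Units.val_mul, ← Units.val_mul, hN'] at h4
      rw [h4, squarefree_minpoly_blockTwoOneGL_iff hp] at hN
      exact hN
    · rintro ⟨P, _, ⟨x, hx, rfl⟩, h⟩
      obtain ⟨rfl, rfl⟩ := Prod.ext_iff.1 h
      have hch : (((P * blockTwoOneGL (s, b) * P⁻¹ : GL (Fin 3) F)) :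
          Matrix (Fin 3) (Fin 3) F).charpoly = doubleRootCubic (a : F) b := by
        rw [Units.val_mul, Units.val_mul, charpoly_units_mul_mul_inv, coe_blockTwoOneGL,
          charpoly_blockTwoOne, hsc, doubleRootCubic]
      refine ⟨⟨?_, ?_, ?_⟩, hch⟩
      · exact (blockTwoOneGL_scalar_commute a b x).map (MulAut.conj P)
      · exact (squarefree_minpoly_conj_blockTwoOne_iff hab' hsc).2 rfl
      · exact (congrArg Squarefree (minpoly_units_mul_mul_inv P _)).mpr
          ((squarefree_minpoly_blockTwoOneGL_iff hp x).2 hx)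

theorem card_commuting_charpoly_eq_doubleRootCubic_of_eq (a : Fˣ) :
    Nat.card {XY : GL (Fin 3) F × GL (Fin 3) F // (Commute XY.1 XY.2 ∧
        Squarefree (minpoly F (XY.1 : Matrix (Fin 3) (Fin 3) F)) ∧
        Squarefree (minpoly F (XY.2 : Matrix (Fin 3) (Fin 3) F))) ∧
        (XY.1 : Matrix (Fin 3) (Fin 3) F).charpoly = doubleRootCubic (a : F) a}
      = Nat.card {Y : GL (Fin 3) F // Squarefree (minpoly F (Y : Matrix (Fin 3) (Fin 3) F))} := by
  set s : GL (Fin 3) F := Units.map (Matrix.scalar (Fin 3)).toMonoidHom a with hs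
  have hsc : (s : Matrix (Fin 3) (Fin 3) F).charpoly = (X - C (a : F)) ^ 3 :=
    charpoly_scalar 3 (a : F)
  refine Nat.card_eq_of_bijective (fun XY => ⟨XY.1.2, XY.2.1.2.2⟩) ⟨?_, fun Y => ?_⟩
  · have key (X : GL (Fin 3) F) (h : (X : Matrix (Fin 3) (Fin 3) F).charpoly =
        doubleRootCubic (a : F) a) (hX : Squarefree (minpoly F (X : Matrix (Fin 3) (Fin 3) F))) :
        X = s :=
      Units.ext ((squarefree_minpoly_iff_eq_scalar three_ne_zero
        (h.trans (doubleRootCubic_self _))).1 hX)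
    rintro ⟨⟨M, N⟩, ⟨_, hM, _⟩, hc⟩ ⟨⟨M', N'⟩, ⟨_, hM', _⟩, hc'⟩ h
    exact Subtype.ext (Prod.ext ((key M hc hM).trans (key M' hc' hM').symm)
      (congrArg Subtype.val h))
  · refine ⟨⟨(s, Y.1), ⟨Units.ext ?_, ?_, Y.2⟩, hsc.trans (doubleRootCubic_self _).symm⟩, rfl⟩
    · exact (Matrix.scalar_commute (a : F) (fun r => mul_comm _ _) _).eq
    · exact (squarefree_minpoly_iff_eq_scalar three_ne_zero hsc).2 rfl

theorem card_commuting_squarefree_minpoly [Finite F] (hp : p.Prime) [CharP F p] :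
    (Nat.card {XY : GL (Fin 3) F × GL (Fin 3) F // Commute XY.1 XY.2 ∧
        Squarefree (minpoly F (XY.1 : Matrix (Fin 3) (Fin 3) F)) ∧
        Squarefree (minpoly F (XY.2 : Matrix (Fin 3) (Fin 3) F))} : ℤ)
      = Nat.card (GL (Fin 3) F) * (Nat.card Fˣ * Nat.card F ^ 2 - Nat.card Fˣ ^ 2)
        + Nat.card Fˣ *
          (Nat.card {Y : GL (Fin 3) F // Squarefree (minpoly F (Y : Matrix (Fin 3) (Fin 3) F))}
            + (Nat.card Fˣ - 1) * (Nat.card F ^ 2 * (Nat.card F ^ 2 + Nat.card F + 1) *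
            (Nat.card {Y : GL (Fin 2) F // Squarefree (minpoly F (Y : Matrix (Fin 2) (Fin 2) F))}
              * Nat.card Fˣ))) := by
  have := Fintype.ofFinite Fˣ
  have h1 := Nat.card_subtype_eq_add (fun XY : GL (Fin 3) F × GL (Fin 3) F => Commute XY.1 XY.2 ∧
        Squarefree (minpoly F (XY.1 : Matrix (Fin 3) (Fin 3) F)) ∧
        Squarefree (minpoly F (XY.2 : Matrix (Fin 3) (Fin 3) F)))
    (fun XY => Squarefree (XY.1 : Matrix (Fin 3) (Fin 3) F).charpoly)
  have h2 : ∀ XY : GL (Fin 3) F × GL (Fin 3) F, ((Commute XY.1 XY.2 ∧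
        Squarefree (minpoly F (XY.1 : Matrix (Fin 3) (Fin 3) F)) ∧
        Squarefree (minpoly F (XY.2 : Matrix (Fin 3) (Fin 3) F))) ∧
          Squarefree (XY.1 : Matrix (Fin 3) (Fin 3) F).charpoly) ↔
      (Commute XY.1 XY.2 ∧ Squarefree (XY.1 : Matrix (Fin 3) (Fin 3) F).charpoly) := fun XY =>
    ⟨fun h => ⟨h.1.1, h.2⟩, fun h => ⟨⟨h.1, squarefree_minpoly_of_squarefree_charpoly h.2,
      (coprime_orderOf_iff_squarefree_minpoly hp _).1
        (coprime_orderOf_of_commute hp h.2 h.1)⟩, h.2⟩⟩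
  rw [Nat.card_congr (Equiv.subtypeEquivRight h2), card_commuting_of_squarefree_charpoly] at h1
  simp only [not_squarefree_charpoly_iff] at h1
  rw [Nat.card_subtype_exists_eq_sum _ (fun XY : GL (Fin 3) F × GL (Fin 3) F =>
      (XY.1 : Matrix (Fin 3) (Fin 3) F).charpoly) _ doubleRootCubic_units_injective] at h1
  have h3 := card_squarefree_monicCubic (F := F)
  zify at h1 h3
  rw [h1, ← h3, add_sub_cancel_right]
  congr 1
  refine sum_units_prod _ _ _ (fun a => ?_) fun a b hab => ?_
  · exact congrArg _ (card_commuting_charpoly_eq_doubleRootCubic_of_eq a)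
  · rw [cast_eq_mul_of_mul_card_eq (card_commuting_charpoly_eq_doubleRootCubic_of_ne hp hab),
      Nat.cast_mul]

end Pairs

end

/-- The number of ordered pairs of commuting semisimple (order prime to `p`) matrices in
`GL_3(F_q)` is `q^12 - 2q^11 - q^10 + 4q^9 - q^8 - 4q^6 + 2q^5 + 3q^4 - 2q^3 + q^2 - 2q + 1`. -/
theorem card_commuting_semisimple_pairs_GL3
    (p : ℕ) (hp : p.Prime) (F : Type*) [Field F] [Fintype F] [CharP F p]
    (q : ℤ) (hq : (Fintype.card F : ℤ) = q) :
    (Nat.card {XY : GL (Fin 3) F × GL (Fin 3) F //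
        Commute XY.1 XY.2 ∧ Nat.Coprime (orderOf XY.1) p ∧ Nat.Coprime (orderOf XY.2) p} : ℤ) =
      q ^ 12 - 2 * q ^ 11 - q ^ 10 + 4 * q ^ 9 - q ^ 8 - 4 * q ^ 6 + 2 * q ^ 5 + 3 * q ^ 4
        - 2 * q ^ 3 + q ^ 2 - 2 * q + 1 := by
  simp only [coprime_orderOf_iff_squarefree_minpoly hp]
  rw [← Nat.card_eq_fintype_card] at hq
  have h2 := card_squarefree_minpoly_GL_two (F := F)
  have hu : (Nat.card Fˣ : ℤ) = q - 1 := by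
    rw [← hq, ← card_units_add_one (F := F)]; push_cast; ring
  zify at h2
  rw [card_commuting_squarefree_minpoly hp, card_squarefree_minpoly_GL_three,
    eq_sub_of_add_eq h2, card_GL_two, card_GL_three, hu, hq]
  ring
end
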